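/- arXiv:0705.1961 — 5 statements merged into one kernel-verified Lean document; each statement's English description precedes it below -/
import Mathlib

section
/- Let (𝔄,(A_i)_{i∈𝓛}) be an 𝓛-graded C*-algebra. If F ⊆ 𝓛 is a finite subset closed under ∧, then the linear span 𝔄_F = Σ_{i∈F} A_i is a closed subset of 𝔄 (hence a C*-subalgebra of 𝔄). -/
/-- Let `B` be a closed `*`-subalgebra and `J` a closed self-adjoint multiplicative subspace which is
stable under multiplication by `B` and meets `B` trivially. The projection `b + j ↦ b` is then
contractive. -/
lemma NonUnitalStarSubalgebra.norm_le_norm_add {𝔄 : Type*} [NonUnitalCStarAlgebra 𝔄]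
    (B : NonUnitalStarSubalgebra ℂ 𝔄) (J : Submodule ℂ 𝔄)
    (hB : IsClosed (B : Set 𝔄)) (hJ : IsClosed (J : Set 𝔄))
    (hJJ : ∀ x ∈ J, ∀ y ∈ J, x * y ∈ J) (hstar : ∀ x ∈ J, star x ∈ J)
    (hBJ : ∀ x ∈ B, ∀ y ∈ J, x * y ∈ J) (hJB : ∀ x ∈ J, ∀ y ∈ B, x * y ∈ J)
    (hdisj : ∀ x ∈ B, x ∈ J → x = 0) {b j : 𝔄} (hb : b ∈ B) (hj : j ∈ J) :
    ‖b‖ ≤ ‖b + j‖ := by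
  let D : NonUnitalStarSubalgebra ℂ (𝔄 × 𝔄) :=
    { carrier := {p | p.1 ∈ B ∧ p.2 - p.1 ∈ J}
      zero_mem' := by simp
      add_mem' := by
        rintro p q ⟨hp, hp'⟩ ⟨hq, hq'⟩
        refine ⟨add_mem hp hq, ?_⟩
        have h : (p + q).2 - (p + q).1 = (p.2 - p.1) + (q.2 - q.1) := by
          simp only [Prod.fst_add, Prod.snd_add]; abel
        exact h ▸ add_mem hp' hq'
      mul_mem' := by
        rintro p q ⟨hp, hp'⟩ ⟨hq, hq'⟩
        refine ⟨mul_mem hp hq, ?_⟩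
        have h : (p * q).2 - (p * q).1 =
            p.1 * (q.2 - q.1) + (p.2 - p.1) * q.1 + (p.2 - p.1) * (q.2 - q.1) := by
          simp only [Prod.fst_mul, Prod.snd_mul]; noncomm_ring
        exact h ▸ add_mem (add_mem (hBJ _ hp _ hq') (hJB _ hp' _ hq)) (hJJ _ hp' _ hq')
      smul_mem' := by
        rintro c p ⟨hp, hp'⟩
        refine ⟨SMulMemClass.smul_mem c hp, ?_⟩
        have h : (c • p).2 - (c • p).1 = c • (p.2 - p.1) := by
          simp [smul_sub]
        exact h ▸ J.smul_mem c hp'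
      star_mem' := by
        rintro p ⟨hp, hp'⟩
        refine ⟨star_mem hp, ?_⟩
        have h : (star p).2 - (star p).1 = star (p.2 - p.1) := by simp
        exact h ▸ hstar _ hp' }
  have hD : IsClosed (D : Set (𝔄 × 𝔄)) :=
    (hB.preimage continuous_fst).inter (hJ.preimage (continuous_snd.sub continuous_fst))
  have hinj : Function.Injective
      ((NonUnitalStarAlgHom.snd ℂ 𝔄 𝔄).comp (NonUnitalStarSubalgebraClass.subtype D)) := by
    refine (injective_iff_map_eq_zero _).2 ?_
    rintro ⟨⟨u, v⟩, hu, huv⟩ (rfl : v = 0)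
    have hu0 : u = 0 := hdisj u hu (by simpa using huv)
    subst hu0
    rfl
  have hx : (b, b + j) ∈ D := ⟨hb, by simpa using hj⟩
  have h := NonUnitalStarAlgHom.norm_map _ hinj ⟨(b, b + j), hx⟩
  calc ‖b‖ ≤ ‖(b, b + j)‖ := norm_fst_le (b, b + j)
    _ = ‖b + j‖ := h.symm

/-- If the projection `b + j ↦ b` is contractive on the sum of two complete subspaces, then the sum
is closed. -/
lemma Submodule.isClosed_sup_of_norm_le_norm_add {E : Type*} [NormedAddCommGroup E]
    [NormedSpace ℂ E] [CompleteSpace E] (B J : Submodule ℂ E)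
    (hB : IsClosed (B : Set E)) (hJ : IsClosed (J : Set E))
    (h : ∀ b ∈ B, ∀ j ∈ J, ‖b‖ ≤ ‖b + j‖) : IsClosed ((B ⊔ J : Submodule ℂ E) : Set E) := by
  have := hB.completeSpace_coe
  have := hJ.completeSpace_coe
  let T : B × J →L[ℂ] E := B.subtypeL.coprod J.subtypeL
  have hT : AntilipschitzWith 2 T := by
    refine T.antilipschitz_of_bound fun ⟨b, j⟩ ↦ ?_
    have h₁ : ‖(b : E)‖ ≤ ‖(b : E) + j‖ := h b b.2 j j.2
    have h₂ : ‖(j : E)‖ ≤ ‖(b : E) + j‖ + ‖(b : E)‖ := by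
      simpa using norm_sub_le ((b : E) + j) b
    have h₃ : T (b, j) = (b : E) + j := rfl
    have h₄ := norm_nonneg ((b : E) + j)
    rw [h₃, Prod.norm_def]
    refine max_le ?_ ?_ <;> simp only [Submodule.coe_norm, NNReal.coe_ofNat] <;> linarith
  have hrange : ((B ⊔ J : Submodule ℂ E) : Set E) = Set.range T := by
    ext x
    simp only [SetLike.mem_coe, Submodule.mem_sup, Set.mem_range, Prod.exists, Subtype.exists]
    exact ⟨fun ⟨b, hb, j, hj, e⟩ ↦ ⟨b, hb, j, hj, e⟩, fun ⟨b, hb, j, hj, e⟩ ↦ ⟨b, hb, j, hj, e⟩⟩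
  rw [hrange]
  exact hT.isClosed_range T.uniformContinuous

section Grading

variable {𝓛 : Type*} {𝔄 : Type*} [NonUnitalCStarAlgebra 𝔄]
  (A : 𝓛 → NonUnitalStarSubalgebra ℂ 𝔄)

lemma mem_span_biUnion_iff_exists_sum (F : Finset 𝓛) (x : 𝔄) :
    x ∈ Submodule.span ℂ (⋃ i ∈ (F : Set 𝓛), (A i : Set 𝔄)) ↔
      ∃ y : 𝓛 → 𝔄, (∀ i, y i ∈ A i) ∧ ∑ i ∈ F, y i = x := by
  have h : Submodule.span ℂ (⋃ i ∈ (F : Set 𝓛), (A i : Set 𝔄)) =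
      ⨆ i ∈ F, (A i).toSubmodule := by
    simp only [Submodule.span_iUnion, Finset.mem_coe]
    exact iSup_congr fun i ↦ iSup_congr fun _ ↦ Submodule.span_eq (A i).toSubmodule
  rw [h, Submodule.mem_iSup_finset_iff_exists_sum]
  exact ⟨fun ⟨y, hy⟩ ↦ ⟨fun i ↦ y i, fun i ↦ (y i).2, hy⟩,
    fun ⟨y, hy, e⟩ ↦ ⟨fun i ↦ ⟨y i, hy i⟩, e⟩⟩

lemma span_biUnion_insert [DecidableEq 𝓛] (m : 𝓛) (F : Finset 𝓛) :
    Submodule.span ℂ (⋃ i ∈ ((insert m F : Finset 𝓛) : Set 𝓛), (A i : Set 𝔄)) =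
      (A m).toSubmodule ⊔ Submodule.span ℂ (⋃ i ∈ (F : Set 𝓛), (A i : Set 𝔄)) := by
  rw [Finset.coe_insert, Set.biUnion_insert, Submodule.span_union]
  congr 1
  exact Submodule.span_eq (A m).toSubmodule

lemma star_mem_span_biUnion (F : Finset 𝓛) {x : 𝔄}
    (hx : x ∈ Submodule.span ℂ (⋃ i ∈ (F : Set 𝓛), (A i : Set 𝔄))) :
    star x ∈ Submodule.span ℂ (⋃ i ∈ (F : Set 𝓛), (A i : Set 𝔄)) := by
  rw [mem_span_biUnion_iff_exists_sum] at hx ⊢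
  obtain ⟨y, hy, rfl⟩ := hx
  exact ⟨fun i ↦ star (y i), fun i ↦ star_mem (hy i), (star_sum _ _).symm⟩

lemma mul_mem_span_biUnion [SemilatticeInf 𝓛]
    (hA_mul : ∀ i j : 𝓛, ∀ x ∈ A i, ∀ y ∈ A j, x * y ∈ A (i ⊓ j))
    (F G H : Finset 𝓛) (hFG : ∀ i ∈ F, ∀ j ∈ G, i ⊓ j ∈ H) {x y : 𝔄}
    (hx : x ∈ Submodule.span ℂ (⋃ i ∈ (F : Set 𝓛), (A i : Set 𝔄)))
    (hy : y ∈ Submodule.span ℂ (⋃ i ∈ (G : Set 𝓛), (A i : Set 𝔄))) :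
    x * y ∈ Submodule.span ℂ (⋃ i ∈ (H : Set 𝓛), (A i : Set 𝔄)) := by
  rw [mem_span_biUnion_iff_exists_sum] at hx hy
  obtain ⟨u, hu, rfl⟩ := hx
  obtain ⟨v, hv, rfl⟩ := hy
  rw [Finset.sum_mul_sum]
  exact sum_mem fun i hi ↦ sum_mem fun j hj ↦ Submodule.subset_span <|
    Set.mem_biUnion (hFG i hi j hj) (hA_mul i j _ (hu i) _ (hv j))

lemma eq_zero_of_mem_of_mem_span_biUnion
    (hA_indep : ∀ (s : Finset 𝓛) (x : 𝓛 → 𝔄), (∀ i, x i ∈ A i) →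
        ∑ i ∈ s, x i = 0 → ∀ i ∈ s, x i = 0)
    {F : Finset 𝓛} {m : 𝓛} (hm : m ∉ F) {x : 𝔄} (hx : x ∈ A m)
    (hxF : x ∈ Submodule.span ℂ (⋃ i ∈ (F : Set 𝓛), (A i : Set 𝔄))) : x = 0 := by
  classical
  rw [mem_span_biUnion_iff_exists_sum] at hxF
  obtain ⟨y, hy, rfl⟩ := hxF
  have key := hA_indep (insert m F) (Function.update y m (-∑ i ∈ F, y i)) (fun i ↦ by
    rcases eq_or_ne i m with rfl | h
    · simpa using hx
    · simpa [h] using hy i) (by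
    rw [Finset.sum_insert hm, Finset.sum_update_of_notMem hm]; simp) m (Finset.mem_insert_self m F)
  simpa using key

lemma isClosed_span_biUnion_of_inf_closed [SemilatticeInf 𝓛]
    (hA_closed : ∀ i : 𝓛, IsClosed ((A i : Set 𝔄)))
    (hA_indep : ∀ (s : Finset 𝓛) (x : 𝓛 → 𝔄), (∀ i, x i ∈ A i) →
        ∑ i ∈ s, x i = 0 → ∀ i ∈ s, x i = 0)
    (hA_mul : ∀ i j : 𝓛, ∀ x ∈ A i, ∀ y ∈ A j, x * y ∈ A (i ⊓ j))
    (F : Finset 𝓛) (hF : ∀ i ∈ F, ∀ j ∈ F, i ⊓ j ∈ F) :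
    IsClosed ((Submodule.span ℂ (⋃ i ∈ (F : Set 𝓛), (A i : Set 𝔄)) : Submodule ℂ 𝔄) : Set 𝔄) := by
  classical
  induction F using Finset.strongInduction with
  | H F ih =>
  rcases F.eq_empty_or_nonempty with rfl | hne
  · simp
  obtain ⟨m, hm⟩ := F.exists_maximal hne
  have hmF : m ∈ F := hm.prop
  have hle : ∀ i ∈ F, m ≤ i → i = m := fun i hi h ↦ le_antisymm (hm.le_of_ge hi h) h
  have hr : ∀ i ∈ F, ∀ j ∈ F.erase m, i ⊓ j ∈ F.erase m := by
    intro i hi j hj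
    obtain ⟨hjm, hj⟩ := Finset.mem_erase.1 hj
    exact Finset.mem_erase.2 ⟨fun h ↦ hjm (hle j hj (h ▸ inf_le_right)), hF i hi j hj⟩
  have hsub : ∀ i ∈ F.erase m, i ∈ F := fun i ↦ Finset.mem_of_mem_erase
  have hsingle : ∀ x ∈ A m, x ∈ Submodule.span ℂ (⋃ i ∈ (F : Set 𝓛), (A i : Set 𝔄)) :=
    fun x hx ↦ Submodule.subset_span (Set.mem_biUnion hmF hx)
  have hJ := ih (F.erase m) (Finset.erase_ssubset hmF) fun i hi j hj ↦ hr i (hsub i hi) j hj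
  rw [← Finset.insert_erase hmF, span_biUnion_insert]
  refine Submodule.isClosed_sup_of_norm_le_norm_add _ _ (hA_closed m) hJ fun b hb j hj ↦
    (A m).norm_le_norm_add _ (hA_closed m) hJ
      (fun x hx y hy ↦ mul_mem_span_biUnion A hA_mul _ _ _
        (fun i hi j hj ↦ hr i (hsub i hi) j hj) hx hy)
      (fun x hx ↦ star_mem_span_biUnion A _ hx)
      (fun x hx y hy ↦ mul_mem_span_biUnion A hA_mul _ _ _ hr (hsingle x hx) hy)
      (fun x hx y hy ↦ mul_mem_span_biUnion A hA_mul _ _ _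
        (fun i hi j hj ↦ inf_comm j i ▸ hr j hj i hi) hx (hsingle y hy))
      (fun x hx hx' ↦ eq_zero_of_mem_of_mem_span_biUnion A hA_indep (Finset.notMem_erase m F) hx hx')
      hb hj

end Grading

theorem stmt_3
    {𝓛 : Type*} [SemilatticeInf 𝓛]
    {𝔄 : Type*} [NonUnitalNormedRing 𝔄] [StarRing 𝔄] [CStarRing 𝔄]
    [NormedSpace ℂ 𝔄] [IsScalarTower ℂ 𝔄 𝔄] [SMulCommClass ℂ 𝔄 𝔄]
    [StarModule ℂ 𝔄] [CompleteSpace 𝔄]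
    (A : 𝓛 → NonUnitalStarSubalgebra ℂ 𝔄)
    (hA_closed : ∀ i : 𝓛, IsClosed ((A i : Set 𝔄)))
    (hA_indep : ∀ (s : Finset 𝓛) (x : 𝓛 → 𝔄), (∀ i, x i ∈ A i) →
        ∑ i ∈ s, x i = 0 → ∀ i ∈ s, x i = 0)
    (hA_total : closure ((Submodule.span ℂ (⋃ i : 𝓛, (A i : Set 𝔄)) : Submodule ℂ 𝔄) : Set 𝔄) = Set.univ)
    (hA_mul : ∀ i j : 𝓛, ∀ x ∈ A i, ∀ y ∈ A j, x * y ∈ A (i ⊓ j))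
    (F : Finset 𝓛) (hF : ∀ i ∈ F, ∀ j ∈ F, i ⊓ j ∈ F) :
    IsClosed ((Submodule.span ℂ (⋃ i ∈ (F : Set 𝓛), (A i : Set 𝔄)) : Submodule ℂ 𝔄) : Set 𝔄) := by
  let _ : NonUnitalCStarAlgebra 𝔄 := {}
  exact isClosed_span_biUnion_of_inf_closed A hA_closed hA_indep hA_mul F hF
end

section
/- Let (𝔄,(A_i)_{i∈𝓛}) be an 𝓛-graded C*-algebra, B a C*-algebra, and ψ : 𝔄 → B a *-homomorphism; write ψ_i for the restriction of ψ to A_i. Then: (b) ψ is surjective if and only if the closed linear span of ⋃_{i∈𝓛} ψ(A_i) equals B; (c) ψ is injective if and only if every ψ_i is injective and the family of subspaces (ψ(A_i))_{i∈𝓛} of B is linearly independent, i.e. every finitely supported family (y_i) with y_i ∈ ψ(A_i) and Σ_i y_i = 0 satisfies y_i = 0 for all i. -/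
/-- The image of a selfadjoint element under a star homomorphism between C⋆-algebras has a preimage
of no larger norm. -/
lemma NonUnitalStarAlgHom.exists_norm_le_of_isSelfAdjoint {A B : Type*} [NonUnitalCStarAlgebra A]
    [NonUnitalCStarAlgebra B] (φ : A →⋆ₙₐ[ℂ] B) {a : A} (ha : IsSelfAdjoint a) :
    ∃ b, φ b = φ a ∧ ‖b‖ ≤ ‖φ a‖ := by
  set r := ‖φ a‖
  have hr : 0 ≤ r := norm_nonneg _
  let f : ℝ → ℝ := fun x ↦ max (-r) (min x r)
  have hf : Continuous f := by fun_prop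
  have hf₀ : f 0 = 0 := by simp [f, hr]
  have hφa : IsSelfAdjoint (φ a) := ha.map φ
  have hφ : Continuous φ := open scoped CStarAlgebra in map_continuous φ
  refine ⟨cfcₙ f a, ?_, norm_cfcₙ_le fun x _ ↦ ?_⟩
  · calc φ (cfcₙ f a) = cfcₙ f (φ a) :=
        NonUnitalStarAlgHomClass.map_cfcₙ (φ.restrictScalars ℝ) f a hf.continuousOn hf₀ hφ ha hφa
      _ = cfcₙ (fun x : ℝ ↦ x) (φ a) := by
        refine cfcₙ_congr fun x hx ↦ ?_
        have h := norm_apply_le_norm_cfcₙ (fun x : ℝ ↦ x) (φ a) hx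
        rw [cfcₙ_id' ℝ (φ a), Real.norm_eq_abs, abs_le] at h
        simp only [f]
        rw [min_eq_left h.2, max_eq_right h.1]
      _ = φ a := cfcₙ_id' ℝ (φ a)
  · rw [Real.norm_eq_abs, abs_le]
    exact ⟨le_max_left _ _, max_le (by linarith) (min_le_right _ _)⟩

/-- The range of a star homomorphism between C⋆-algebras is closed. -/
lemma NonUnitalStarAlgHom.isClosed_range {A B : Type*} [NonUnitalCStarAlgebra A]
    [NonUnitalCStarAlgebra B] (φ : A →⋆ₙₐ[ℂ] B) : IsClosed (Set.range φ) := by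
  let g : NormedAddGroupHom A B := (φ : A →+ B).mkNormedAddGroupHom 1 fun x ↦ by
    simpa using NonUnitalStarAlgHom.norm_apply_le φ x
  have hg : g.SurjectiveOnWith g.range 2 := by
    rintro _ ⟨a, rfl⟩
    obtain ⟨b, hb, hb'⟩ := φ.exists_norm_le_of_isSelfAdjoint (realPart a).property
    obtain ⟨c, hc, hc'⟩ := φ.exists_norm_le_of_isSelfAdjoint (imaginaryPart a).property
    refine ⟨b + Complex.I • c, ?_, ?_⟩
    · change φ (b + Complex.I • c) = φ a
      rw [map_add, map_smul, hb, hc, ← map_smul, ← map_add, realPart_add_I_smul_imaginaryPart]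
    · change _ ≤ 2 * ‖φ a‖
      calc ‖b + Complex.I • c‖ ≤ ‖b‖ + ‖c‖ := by
            simpa [norm_smul] using norm_add_le b (Complex.I • c)
        _ ≤ ‖φ a‖ + ‖φ a‖ := by
            refine add_le_add (hb'.trans ?_) (hc'.trans ?_)
            · rw [map_realPart]; exact realPart.norm_le (φ a)
            · rw [map_imaginaryPart]; exact imaginaryPart.norm_le (φ a)
        _ = 2 * ‖φ a‖ := by ring
  have h := controlled_closure_of_complete two_pos one_pos hg
  refine isClosed_of_closure_subset fun y hy ↦ ?_
  obtain ⟨x, hx, -⟩ := h y hy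
  exact ⟨x, hx⟩

/-- If `C` and `J` are closed star subalgebras of a C⋆-algebra such that `J` absorbs products with
`C`, then `C + J` is a closed star subalgebra. -/
lemma NonUnitalStarSubalgebra.exists_isClosed_add {A : Type*} [NonUnitalCStarAlgebra A]
    (C J : NonUnitalStarSubalgebra ℂ A) (hC : IsClosed (C : Set A)) (hJ : IsClosed (J : Set A))
    (hCJ : ∀ c ∈ C, ∀ j ∈ J, c * j ∈ J) :
    ∃ S : NonUnitalStarSubalgebra ℂ A, IsClosed (S : Set A) ∧
      ∀ x, x ∈ S ↔ ∃ c ∈ C, ∃ j ∈ J, x = c + j := by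
  have hJC : ∀ c ∈ C, ∀ j ∈ J, j * c ∈ J := fun c hc j hj ↦ by
    simpa using star_mem (hCJ _ (star_mem hc) _ (star_mem hj))
  let T : NonUnitalStarSubalgebra ℂ (A × A) :=
    { carrier := {p | p.2 ∈ C ∧ p.1 - p.2 ∈ J}
      zero_mem' := by simp
      add_mem' := fun {p q} hp hq ↦ ⟨add_mem hp.1 hq.1, by
        simpa [add_sub_add_comm] using add_mem hp.2 hq.2⟩
      smul_mem' := fun z p hp ↦ ⟨SMulMemClass.smul_mem z hp.1, by
        simpa [smul_sub] using SMulMemClass.smul_mem z hp.2⟩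
      star_mem' := fun {p} hp ↦ ⟨star_mem hp.1, by
        simpa using star_mem hp.2⟩
      mul_mem' := fun {p q} hp hq ↦ ⟨mul_mem hp.1 hq.1, by
        have : p.1 * q.1 - p.2 * q.2 =
            (p.1 - p.2) * (q.1 - q.2) + p.2 * (q.1 - q.2) + (p.1 - p.2) * q.2 := by
          noncomm_ring
        simpa [this] using add_mem (add_mem (mul_mem hp.2 hq.2) (hCJ _ hp.1 _ hq.2))
          (hJC _ hq.1 _ hp.2)⟩ }
  have hT : IsClosed (T : Set (A × A)) :=
    (hC.preimage continuous_snd).inter (hJ.preimage (continuous_fst.sub continuous_snd))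
  let π : T →⋆ₙₐ[ℂ] A := (NonUnitalStarAlgHom.fst ℂ A A).comp
    (NonUnitalStarSubalgebraClass.subtype T)
  have hπ : IsClosed (Set.range π) := π.isClosed_range
  refine ⟨NonUnitalStarAlgHom.range π, by simpa using hπ, fun x ↦ ?_⟩
  constructor
  · rintro ⟨⟨p, hp⟩, rfl⟩
    exact ⟨p.2, hp.1, p.1 - p.2, hp.2, (add_sub_cancel _ _).symm⟩
  · rintro ⟨c, hc, j, hj, rfl⟩
    exact ⟨⟨(c + j, c), hc, by simpa using hj⟩, rfl⟩

/-- In a graded C⋆-algebra, the sum of finitely many components indexed by a set closed under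
meets is a closed star subalgebra. -/
lemma exists_isClosed_sum_graded {L : Type*} [SemilatticeInf L] {A : Type*}
    [NonUnitalCStarAlgebra A] (G : L → NonUnitalStarSubalgebra ℂ A)
    (hclosed : ∀ i, IsClosed (G i : Set A))
    (hmul : ∀ i j, ∀ x ∈ G i, ∀ y ∈ G j, x * y ∈ G (i ⊓ j))
    (F : Finset L) (hF : ∀ i ∈ F, ∀ j ∈ F, i ⊓ j ∈ F) :
    ∃ S : NonUnitalStarSubalgebra ℂ A, IsClosed (S : Set A) ∧
      ∀ x, x ∈ S ↔ ∃ f : L → A, (∀ i, f i ∈ G i) ∧ x = ∑ i ∈ F, f i := by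
  classical
  induction F using Finset.strongInduction with
  | H F ih =>
  rcases F.eq_empty_or_nonempty with rfl | hne
  · refine ⟨⊥, by simp, fun x ↦ ?_⟩
    simp only [NonUnitalStarAlgebra.mem_bot, Finset.sum_empty]
    exact ⟨fun h ↦ ⟨0, fun i ↦ zero_mem _, h⟩, fun ⟨_, _, h⟩ ↦ h⟩
  obtain ⟨m, hm, hmax⟩ := F.exists_maximal hne
  replace hmax : ∀ i ∈ F, m ≤ i → i = m := fun i hi h ↦ le_antisymm (hmax hi h) h
  have herase : ∀ i ∈ F, ∀ j ∈ F.erase m, i ⊓ j ∈ F.erase m := fun i hi j hj ↦ by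
    rw [Finset.mem_erase] at hj ⊢
    exact ⟨fun h ↦ hj.1 (hmax j hj.2 (h ▸ inf_le_right)), hF i hi j hj.2⟩
  obtain ⟨J, hJ, hmem⟩ := ih (F.erase m) (F.erase_ssubset hm)
    fun i hi j hj ↦ herase i (F.mem_of_mem_erase hi) j hj
  have hle : ∀ i ∈ F.erase m, ∀ x ∈ G i, x ∈ J := fun i hi x hx ↦ by
    refine (hmem x).2 ⟨Pi.single i x, fun k ↦ ?_, ?_⟩
    · by_cases h : k = i
      · subst h; simpa using hx
      · simp [h]
    · rw [Finset.sum_pi_single', if_pos hi]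
  obtain ⟨S, hS, hmemS⟩ := NonUnitalStarSubalgebra.exists_isClosed_add (G m) J (hclosed m) hJ
    (fun c hc j hj ↦ by
      obtain ⟨f, hf, rfl⟩ := (hmem j).1 hj
      rw [Finset.mul_sum]
      exact sum_mem fun i hi ↦ hle _ (herase m hm i hi) _ (hmul _ _ _ hc _ (hf i)))
  refine ⟨S, hS, fun x ↦ (hmemS x).trans ⟨?_, ?_⟩⟩
  · rintro ⟨c, hc, j, hj, rfl⟩
    obtain ⟨f, hf, rfl⟩ := (hmem j).1 hj
    refine ⟨Function.update f m c, fun i ↦ ?_, ?_⟩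
    · by_cases h : i = m
      · subst h; simpa using hc
      · simpa [h] using hf i
    · rw [← Finset.add_sum_erase F _ hm, Function.update_self]
      congr 1
      exact Finset.sum_congr rfl fun i hi ↦ by simp [Finset.ne_of_mem_erase hi]
  · rintro ⟨f, hf, rfl⟩
    exact ⟨f m, hf m, _, (hmem _).2 ⟨f, hf, rfl⟩, (Finset.add_sum_erase F f hm).symm⟩

/-- A star homomorphism from a graded C⋆-algebra which is injective on the algebraic sum of the
components is injective. -/
lemma injective_of_injective_on_graded_sums {L : Type*} [SemilatticeInf L] {A B : Type*}
    [NonUnitalCStarAlgebra A] [NonUnitalCStarAlgebra B]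
    (G : L → NonUnitalStarSubalgebra ℂ A) (hclosed : ∀ i, IsClosed (G i : Set A))
    (htotal : closure (Submodule.span ℂ (⋃ i, (G i : Set A)) : Set A) = Set.univ)
    (hmul : ∀ i j, ∀ x ∈ G i, ∀ y ∈ G j, x * y ∈ G (i ⊓ j)) (φ : A →⋆ₙₐ[ℂ] B)
    (hφ : ∀ (s : Finset L) (f : L → A), (∀ i, f i ∈ G i) → φ (∑ i ∈ s, f i) = 0 →
      ∑ i ∈ s, f i = 0) :
    Function.Injective φ := by
  classical
  have hspan : ∀ x ∈ Submodule.span ℂ (⋃ i, (G i : Set A)), ‖φ x‖ = ‖x‖ := fun x hx ↦ by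
    have hx' : ∃ (s : Finset L) (f : L → A), (∀ i, f i ∈ G i) ∧ (∀ i ∉ s, f i = 0) ∧
        x = ∑ i ∈ s, f i := by
      induction hx using Submodule.span_induction with
      | mem x hx =>
        obtain ⟨i, hi⟩ := Set.mem_iUnion.1 hx
        refine ⟨{i}, Pi.single i x, fun k ↦ ?_, fun k hk ↦ ?_, by simp⟩
        · by_cases h : k = i
          · subst h; simpa using hi
          · simp [h]
        · simp_all
      | zero => exact ⟨∅, 0, fun i ↦ zero_mem _, by simp, by simp⟩
      | add x y _ _ hx hy =>
        obtain ⟨s, f, hf, hf0, rfl⟩ := hx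
        obtain ⟨t, g, hg, hg0, rfl⟩ := hy
        refine ⟨s ∪ t, f + g, fun i ↦ add_mem (hf i) (hg i), fun i hi ↦ ?_, ?_⟩
        · rw [Finset.notMem_union] at hi
          simp [hf0 i hi.1, hg0 i hi.2]
        · simp only [Pi.add_apply, Finset.sum_add_distrib]
          congr 1
          · exact Finset.sum_subset Finset.subset_union_left fun i _ hi ↦ hf0 i hi
          · exact Finset.sum_subset Finset.subset_union_right fun i _ hi ↦ hg0 i hi
      | smul z x _ hx =>
        obtain ⟨s, f, hf, hf0, rfl⟩ := hx
        exact ⟨s, z • f, fun i ↦ SMulMemClass.smul_mem z (hf i), fun i hi ↦ by simp [hf0 i hi],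
          by simp [Finset.smul_sum]⟩
    obtain ⟨s, f, hf, hf0, rfl⟩ := hx'
    have hfin : (infClosure (s : Set L)).Finite := s.finite_toSet.infClosure
    obtain ⟨S, hS, hmem⟩ := exists_isClosed_sum_graded G hclosed hmul hfin.toFinset
      fun i hi j hj ↦ by
        rw [Set.Finite.mem_toFinset] at *
        exact infClosed_infClosure hi hj
    have hxS : ∑ i ∈ s, f i ∈ S := (hmem _).2 ⟨f, hf, Finset.sum_subset
      (fun i hi ↦ hfin.mem_toFinset.2 (subset_infClosure hi)) fun i _ hi ↦ hf0 i hi⟩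
    let ρ : S →⋆ₙₐ[ℂ] B := φ.comp (NonUnitalStarSubalgebraClass.subtype S)
    have hρ : Function.Injective ρ := by
      refine (injective_iff_map_eq_zero ρ).2 fun ⟨y, hy⟩ h ↦ ?_
      obtain ⟨g, hg, rfl⟩ := (hmem y).1 hy
      exact Subtype.ext (hφ _ g hg h)
    exact NonUnitalStarAlgHom.norm_map ρ hρ ⟨_, hxS⟩
  have hφc : Continuous φ := open scoped CStarAlgebra in map_continuous φ
  have hall : ∀ x, ‖φ x‖ = ‖x‖ := fun x ↦ by
    have hcl : IsClosed {x | ‖φ x‖ = ‖x‖} := isClosed_eq hφc.norm continuous_norm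
    exact closure_minimal hspan hcl (htotal ▸ Set.mem_univ x)
  exact (injective_iff_map_eq_zero φ).2 fun x hx ↦ by
    rw [← norm_eq_zero, ← hall, hx, norm_zero]


theorem stmt_5
    {𝓛 : Type*} [SemilatticeInf 𝓛]
    {𝔄 : Type*} [NonUnitalNormedRing 𝔄] [StarRing 𝔄] [CStarRing 𝔄]
    [NormedSpace ℂ 𝔄] [IsScalarTower ℂ 𝔄 𝔄] [SMulCommClass ℂ 𝔄 𝔄]
    [StarModule ℂ 𝔄] [CompleteSpace 𝔄]
    {B : Type*} [NonUnitalNormedRing B] [StarRing B] [CStarRing B]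
    [NormedSpace ℂ B] [IsScalarTower ℂ B B] [SMulCommClass ℂ B B]
    [StarModule ℂ B] [CompleteSpace B]
    (A : 𝓛 → NonUnitalStarSubalgebra ℂ 𝔄)
    (hA_closed : ∀ i : 𝓛, IsClosed ((A i : Set 𝔄)))
    (hA_indep : ∀ (s : Finset 𝓛) (x : 𝓛 → 𝔄), (∀ i, x i ∈ A i) →
        ∑ i ∈ s, x i = 0 → ∀ i ∈ s, x i = 0)
    (hA_total : closure ((Submodule.span ℂ (⋃ i : 𝓛, (A i : Set 𝔄)) : Submodule ℂ 𝔄) : Set 𝔄) = Set.univ)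
    (hA_mul : ∀ i j : 𝓛, ∀ x ∈ A i, ∀ y ∈ A j, x * y ∈ A (i ⊓ j))
    (ψ : 𝔄 →⋆ₙₐ[ℂ] B) :
    (Function.Surjective ψ ↔
      closure ((Submodule.span ℂ (⋃ i : 𝓛, ψ '' (A i : Set 𝔄)) : Submodule ℂ B) : Set B)
        = Set.univ) ∧
    (Function.Injective ψ ↔
      ((∀ i : 𝓛, ∀ x ∈ A i, ∀ y ∈ A i, ψ x = ψ y → x = y) ∧
       (∀ (s : Finset 𝓛) (y : 𝓛 → B), (∀ i : 𝓛, y i ∈ ψ '' (A i : Set 𝔄)) →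
          ∑ i ∈ s, y i = 0 → ∀ i ∈ s, y i = 0))) := by
  let : NonUnitalCStarAlgebra 𝔄 := {}
  let : NonUnitalCStarAlgebra B := {}
  have hψ : Continuous ψ := open scoped CStarAlgebra in map_continuous ψ
  refine ⟨?_, fun hinj ↦ ⟨fun i x _ y _ h ↦ hinj h, fun s y hy hsum ↦ ?_⟩, ?_⟩
  · have himage : ψ '' (Submodule.span ℂ (⋃ i, (A i : Set 𝔄)) : Set 𝔄) =
        Submodule.span ℂ (⋃ i, ψ '' (A i : Set 𝔄)) := by
      rw [← Set.image_iUnion]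
      exact congrArg (SetLike.coe (A := Submodule ℂ B))
        (Submodule.map_span (ψ : 𝔄 →ₗ[ℂ] B) (⋃ i, (A i : Set 𝔄)))
    rw [← himage]
    constructor
    · refine fun hsurj ↦ Set.eq_univ_of_univ_subset ?_
      calc Set.univ = ψ '' closure (Submodule.span ℂ (⋃ i, (A i : Set 𝔄)) : Set 𝔄) := by
            rw [hA_total, Set.image_univ, hsurj.range_eq]
        _ ⊆ _ := image_closure_subset_closure_image hψ
    · intro h
      rw [← Set.range_eq_univ]
      refine Set.eq_univ_of_univ_subset ?_
      rw [← h]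
      exact closure_minimal (Set.image_subset_range _ _) ψ.isClosed_range
  · choose x hx hxy using hy
    have hx0 := hA_indep s x hx <| hinj <| by simpa [hxy] using hsum
    exact fun i hi ↦ by rw [← hxy, hx0 i hi, map_zero]
  · rintro ⟨hinj, hindep⟩
    refine injective_of_injective_on_graded_sums A hA_closed hA_total hA_mul ψ fun s f hf h ↦ ?_
    rw [map_sum] at h
    have h0 := hindep s (fun i ↦ ψ (f i)) (fun i ↦ ⟨f i, hf i, rfl⟩) h
    exact Finset.sum_eq_zero fun i hi ↦
      hinj i _ (hf i) 0 (zero_mem _) (by rw [map_zero]; exact h0 i hi)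
end

section
/- Let (𝔄,(A_i)_{i∈𝓛}) be an 𝓛-graded C*-algebra and B a C*-algebra. Suppose given, for each i ∈ 𝓛, a *-homomorphism ψ_i : A_i → B such that for all j, k ∈ 𝓛, x ∈ A_j and y ∈ A_k one has ψ_{j∧k}(x·y) = ψ_j(x)·ψ_k(y) (note that x·y ∈ A_{j∧k} by the grading). Then there exists a unique continuous *-homomorphism ψ : 𝔄 → B whose restriction to A_i equals ψ_i for every i ∈ 𝓛. -/
/-- The linear span of the components of a family of star subalgebras with index in `F`. -/
def componentSpan {𝓛 C : Type*} [NonUnitalCStarAlgebra C]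
    (A : 𝓛 → NonUnitalStarSubalgebra ℂ C) (F : Set 𝓛) : Submodule ℂ C :=
  Submodule.span ℂ (⋃ i ∈ F, (A i : Set C))

section ComponentSpan

variable {𝓛 C : Type*} [NonUnitalCStarAlgebra C] {A : 𝓛 → NonUnitalStarSubalgebra ℂ C}

lemma mem_componentSpan_of_mem {F : Set 𝓛} {i : 𝓛} (hi : i ∈ F) {x : C} (hx : x ∈ A i) :
    x ∈ componentSpan A F :=
  Submodule.subset_span (Set.mem_biUnion hi hx)

lemma componentSpan_mono {F G : Set 𝓛} (h : F ⊆ G) : componentSpan A F ≤ componentSpan A G :=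
  Submodule.span_mono (Set.biUnion_subset_biUnion_left h)

lemma star_mem_componentSpan {F : Set 𝓛} {x : C} (hx : x ∈ componentSpan A F) :
    star x ∈ componentSpan A F := by
  induction hx using Submodule.span_induction with
  | mem x hx =>
    simp only [Set.mem_iUnion, SetLike.mem_coe] at hx
    obtain ⟨i, hi, hx⟩ := hx
    exact mem_componentSpan_of_mem hi (star_mem hx)
  | zero => simp
  | add x y _ _ hx hy => simpa using add_mem hx hy
  | smul a x _ hx => simpa using Submodule.smul_mem _ _ hx

lemma mul_mem_componentSpan [SemilatticeInf 𝓛]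
    (hmul : ∀ i j, ∀ x ∈ A i, ∀ y ∈ A j, x * y ∈ A (i ⊓ j)) {F G H : Set 𝓛}
    (h : ∀ i ∈ F, ∀ j ∈ G, i ⊓ j ∈ H) {x y : C}
    (hx : x ∈ componentSpan A F) (hy : y ∈ componentSpan A G) :
    x * y ∈ componentSpan A H := by
  induction hx, hy using Submodule.span_induction₂ with
  | mem_mem x y hx hy =>
    simp only [Set.mem_iUnion, SetLike.mem_coe] at hx hy
    obtain ⟨i, hi, hx⟩ := hx
    obtain ⟨j, hj, hy⟩ := hy
    exact mem_componentSpan_of_mem (h i hi j hj) (hmul i j x hx y hy)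
  | zero_left y _ => simp
  | zero_right x _ => simp
  | add_left x y z _ _ _ hx hy => simpa [add_mul] using add_mem hx hy
  | add_right x y z _ _ _ hx hy => simpa [mul_add] using add_mem hx hy
  | smul_left r x y _ _ h => simpa [smul_mul_assoc] using Submodule.smul_mem _ r h
  | smul_right r x y _ _ h => simpa [mul_smul_comm] using Submodule.smul_mem _ r h

lemma exists_eq_sum_of_mem_componentSpan {F : Finset 𝓛} {x : C}
    (hx : x ∈ componentSpan A (F : Set 𝓛)) :
    ∃ f : 𝓛 → C, (∀ i, f i ∈ A i) ∧ ∑ i ∈ F, f i = x := by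
  classical
  induction hx using Submodule.span_induction with
  | mem x hx =>
    simp only [Set.mem_iUnion, SetLike.mem_coe] at hx
    obtain ⟨i, hi, hx⟩ := hx
    refine ⟨Pi.single i x, fun j ↦ ?_, by simp [Finset.sum_pi_single', hi]⟩
    by_cases hj : j = i
    · subst hj; simpa using hx
    · simp [hj]
  | zero => exact ⟨0, fun i ↦ zero_mem _, by simp⟩
  | add x y _ _ hx hy =>
    obtain ⟨f, hf, rfl⟩ := hx
    obtain ⟨g, hg, rfl⟩ := hy
    exact ⟨f + g, fun i ↦ add_mem (hf i) (hg i), by simp [Finset.sum_add_distrib]⟩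
  | smul a x _ hx =>
    obtain ⟨f, hf, rfl⟩ := hx
    exact ⟨a • f, fun i ↦ SMulMemClass.smul_mem a (hf i), by simp [Finset.smul_sum]⟩

lemma exists_finset_of_mem_componentSpan [SemilatticeInf 𝓛] {F : Set 𝓛} {x : C}
    (hx : x ∈ componentSpan A F) :
    ∃ G : Finset 𝓛, InfClosed (G : Set 𝓛) ∧ x ∈ componentSpan A (G : Set 𝓛) := by
  classical
  suffices ∃ G : Finset 𝓛, x ∈ componentSpan A (G : Set 𝓛) by
    obtain ⟨G, hG⟩ := this
    refine ⟨G.finite_toSet.infClosure.toFinset, ?_, ?_⟩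
    · simp
    · exact componentSpan_mono (by simp) hG
  induction hx using Submodule.span_induction with
  | mem x hx =>
    simp only [Set.mem_iUnion, SetLike.mem_coe] at hx
    obtain ⟨i, hi, hx⟩ := hx
    exact ⟨{i}, mem_componentSpan_of_mem (i := i) (by simp) hx⟩
  | zero => exact ⟨∅, zero_mem _⟩
  | add x y _ _ hx hy =>
    obtain ⟨G, hG⟩ := hx
    obtain ⟨H, hH⟩ := hy
    exact ⟨G ∪ H, add_mem (componentSpan_mono (by simp) hG) (componentSpan_mono (by simp) hH)⟩
  | smul a x _ hx =>
    obtain ⟨G, hG⟩ := hx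
    exact ⟨G, Submodule.smul_mem _ _ hG⟩

/-- The span of the components over an inf-closed set of indices, as a star subalgebra. -/
def componentSubalgebra [SemilatticeInf 𝓛]
    (hmul : ∀ i j, ∀ x ∈ A i, ∀ y ∈ A j, x * y ∈ A (i ⊓ j)) {F : Set 𝓛} (hF : InfClosed F) :
    NonUnitalStarSubalgebra ℂ C where
  toNonUnitalSubalgebra :=
    (componentSpan A F).toNonUnitalSubalgebra fun _ _ ↦
      mul_mem_componentSpan hmul fun _ hi _ hj ↦ hF hi hj
  star_mem' := star_mem_componentSpan

lemma mem_componentSubalgebra [SemilatticeInf 𝓛]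
    {hmul : ∀ i j, ∀ x ∈ A i, ∀ y ∈ A j, x * y ∈ A (i ⊓ j)} {F : Set 𝓛} {hF : InfClosed F}
    {x : C} : x ∈ componentSubalgebra hmul hF ↔ x ∈ componentSpan A F :=
  Iff.rfl

end ComponentSpan

lemma isClosed_range_of_injective {C D : Type*} [NonUnitalCStarAlgebra C]
    [NonUnitalCStarAlgebra D] (φ : C →⋆ₙₐ[ℂ] D) (h : Function.Injective φ) :
    IsClosed (Set.range φ) :=
  (NonUnitalStarAlgHom.isometry φ h).isClosedEmbedding.isClosed_range

/-- In a graded C⋆-algebra the sum of the components over a finite inf-closed set of indices is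
closed. -/
lemma isClosed_componentSpan {𝓛 C : Type*} [SemilatticeInf 𝓛] [NonUnitalCStarAlgebra C]
    {A : 𝓛 → NonUnitalStarSubalgebra ℂ C} (hclosed : ∀ i, IsClosed (A i : Set C))
    (hindep : ∀ (s : Finset 𝓛) (x : 𝓛 → C), (∀ i, x i ∈ A i) →
      ∑ i ∈ s, x i = 0 → ∀ i ∈ s, x i = 0)
    (hmul : ∀ i j, ∀ x ∈ A i, ∀ y ∈ A j, x * y ∈ A (i ⊓ j))
    (F : Finset 𝓛) (hF : InfClosed (F : Set 𝓛)) :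
    IsClosed (componentSpan A (F : Set 𝓛) : Set C) := by
  classical
  induction F using Finset.strongInduction with | H F ih => ?_
  rcases F.eq_empty_or_nonempty with rfl | hne
  · simp [componentSpan]
  obtain ⟨m, hm, hmax⟩ := F.exists_maximal hne
  have hinf : ∀ i ∈ F, ∀ j ∈ F.erase m, i ⊓ j ∈ F.erase m := by
    intro i hi j hj
    rw [Finset.mem_erase] at hj ⊢
    refine ⟨fun h ↦ hj.1 ?_, hF hi hj.2⟩
    have hle : m ≤ j := h ▸ inf_le_right
    exact le_antisymm (hmax hj.2 hle) hle
  have hF' : InfClosed (F.erase m : Set 𝓛) := fun i hi j hj ↦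
    hinf i (Finset.mem_of_mem_erase hi) j hj
  have hJ := ih (F.erase m) (Finset.erase_ssubset hm) hF'
  set J := componentSpan A (F.erase m : Set 𝓛)
  have hleft : ∀ x ∈ A m, ∀ y ∈ J, x * y ∈ J := fun x hx y hy ↦
    mul_mem_componentSpan (F := {m}) hmul (by rintro i rfl j hj; exact hinf i hm j hj)
      (mem_componentSpan_of_mem (Set.mem_singleton m) hx) hy
  have hright : ∀ x ∈ J, ∀ y ∈ A m, x * y ∈ J := fun x hx y hy ↦
    mul_mem_componentSpan (G := {m}) hmul
      (by rintro j hj i rfl; rw [inf_comm]; exact hinf i hm j hj)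
      hx (mem_componentSpan_of_mem (Set.mem_singleton m) hy)
  have hJmul : ∀ x ∈ J, ∀ y ∈ J, x * y ∈ J := fun x hx y hy ↦
    mul_mem_componentSpan hmul (fun i hi j hj ↦ hF' hi hj) hx hy
  have hdisj : ∀ x ∈ A m, x ∈ J → x = 0 := by
    intro x hx hxJ
    obtain ⟨f, hf, hfx⟩ := exists_eq_sum_of_mem_componentSpan hxJ
    have := hindep F (Function.update f m (-x)) (fun i ↦ by
      by_cases hi : i = m
      · subst hi; simpa using hx
      · simpa [hi] using hf i) (by
      rw [← Finset.add_sum_erase _ _ hm, Finset.sum_congr rfl fun i hi ↦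
        Function.update_of_ne (Finset.ne_of_mem_erase hi) _ _, hfx]
      simp) m hm
    simpa using this
  -- The second projection is injective on the pairs `(u, u + j)` with `u ∈ A m`, `j ∈ J`.
  let D : NonUnitalStarSubalgebra ℂ (C × C) :=
    { carrier := {p | p.1 ∈ A m ∧ p.2 - p.1 ∈ J}
      add_mem' := fun {p q} hp hq ↦ ⟨add_mem hp.1 hq.1, by
        have := add_mem hp.2 hq.2
        rwa [← add_sub_add_comm] at this⟩
      zero_mem' := ⟨zero_mem _, by simp⟩
      smul_mem' := fun a p hp ↦ ⟨SMulMemClass.smul_mem a hp.1, by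
        simpa [smul_sub] using J.smul_mem a hp.2⟩
      mul_mem' := fun {p q} hp hq ↦ ⟨mul_mem hp.1 hq.1, by
        have h1 := hJmul _ hp.2 _ hq.2
        have h2 := hleft _ hp.1 _ hq.2
        have h3 := hright _ hp.2 _ hq.1
        have := add_mem (add_mem h1 h2) h3
        convert this using 1
        simp only [Prod.snd_mul, Prod.fst_mul]
        noncomm_ring⟩
      star_mem' := fun {p} hp ↦ ⟨star_mem hp.1, by
        rw [Prod.snd_star, Prod.fst_star, ← star_sub]
        exact star_mem_componentSpan hp.2⟩ }
  have hD : IsClosed (D : Set (C × C)) :=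
    ((hclosed m).preimage continuous_fst).inter
      (hJ.preimage (continuous_snd.sub continuous_fst))
  let φ : D →⋆ₙₐ[ℂ] C :=
    (NonUnitalStarAlgHom.snd ℂ C C).comp (NonUnitalStarSubalgebraClass.subtype D)
  have hφ : Function.Injective φ := by
    rw [injective_iff_map_eq_zero]
    rintro ⟨⟨u, v⟩, hu, huv⟩ (rfl : v = 0)
    have : u = 0 := hdisj u hu (by simpa using huv)
    subst this
    rfl
  convert isClosed_range_of_injective φ hφ
  ext v
  constructor
  · intro hv
    obtain ⟨f, hf, rfl⟩ := exists_eq_sum_of_mem_componentSpan hv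
    refine ⟨⟨(f m, ∑ i ∈ F, f i), hf m, ?_⟩, rfl⟩
    simp only [← Finset.add_sum_erase _ _ hm, add_sub_cancel_left]
    exact sum_mem fun i hi ↦ mem_componentSpan_of_mem (Finset.mem_coe.2 hi) (hf i)
  · rintro ⟨⟨⟨u, v⟩, hu, huv⟩, rfl⟩
    have := add_mem (mem_componentSpan_of_mem (Finset.mem_coe.2 hm) hu)
      (componentSpan_mono (A := A) (Finset.coe_subset.2 (Finset.erase_subset m F)) huv)
    rwa [add_sub_cancel] at this

/-- The graph of a star homomorphism defined on a star subalgebra. -/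
def graphSubalgebra {C B : Type*} [NonUnitalCStarAlgebra C] [NonUnitalCStarAlgebra B]
    {S : NonUnitalStarSubalgebra ℂ C} (φ : S →⋆ₙₐ[ℂ] B) : NonUnitalStarSubalgebra ℂ (C × B) :=
  NonUnitalStarAlgHom.range ((NonUnitalStarSubalgebraClass.subtype S).prod φ)

section Graph

variable {C B : Type*} [NonUnitalCStarAlgebra C] [NonUnitalCStarAlgebra B]
  {S : NonUnitalStarSubalgebra ℂ C}

lemma mem_graphSubalgebra {φ : S →⋆ₙₐ[ℂ] B} {p : C × B} :
    p ∈ graphSubalgebra φ ↔ ∃ x : S, ((x : C), φ x) = p :=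
  NonUnitalStarAlgHom.mem_range _

lemma isClosed_graphSubalgebra (hS : IsClosed (S : Set C)) (φ : S →⋆ₙₐ[ℂ] B) :
    IsClosed (graphSubalgebra φ : Set (C × B)) := by
  have := hS
  rw [graphSubalgebra, NonUnitalStarAlgHom.coe_range]
  refine isClosed_range_of_injective _ fun x y h ↦ ?_
  exact Subtype.ext (congrArg Prod.fst h)

lemma eq_zero_of_mem_graphSubalgebra {φ : S →⋆ₙₐ[ℂ] B} {p : C × B} (hp : p ∈ graphSubalgebra φ)
    (h : p.1 = 0) : p = 0 := by
  obtain ⟨x, rfl⟩ := mem_graphSubalgebra.1 hp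
  obtain rfl : x = 0 := Subtype.ext h
  simp

end Graph

open scoped CStarAlgebra in
/-- Multiplicatively compatible star homomorphisms on the components of a graded C⋆-algebra extend
uniquely to a continuous star homomorphism on the whole algebra. -/
theorem existsUnique_starAlgHom_of_graded
    {𝓛 𝔄 B : Type*} [SemilatticeInf 𝓛] [NonUnitalCStarAlgebra 𝔄] [NonUnitalCStarAlgebra B]
    (A : 𝓛 → NonUnitalStarSubalgebra ℂ 𝔄)
    (hclosed : ∀ i, IsClosed (A i : Set 𝔄))
    (hindep : ∀ (s : Finset 𝓛) (x : 𝓛 → 𝔄), (∀ i, x i ∈ A i) →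
      ∑ i ∈ s, x i = 0 → ∀ i ∈ s, x i = 0)
    (htotal : closure ((Submodule.span ℂ (⋃ i : 𝓛, (A i : Set 𝔄)) : Submodule ℂ 𝔄) : Set 𝔄) =
      Set.univ)
    (hmul : ∀ i j : 𝓛, ∀ x ∈ A i, ∀ y ∈ A j, x * y ∈ A (i ⊓ j))
    (ψ : ∀ i : 𝓛, A i →⋆ₙₐ[ℂ] B)
    (hψ : ∀ (j k : 𝓛) (x : A j) (y : A k),
      ψ (j ⊓ k) ⟨(x : 𝔄) * (y : 𝔄), hmul j k (x : 𝔄) x.2 (y : 𝔄) y.2⟩ = ψ j x * ψ k y) :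
    ∃! Ψ : 𝔄 →⋆ₙₐ[ℂ] B, Continuous Ψ ∧ ∀ (i : 𝓛) (x : A i), Ψ (x : 𝔄) = ψ i x := by
  let G : 𝓛 → NonUnitalStarSubalgebra ℂ (𝔄 × B) := fun i ↦ graphSubalgebra (ψ i)
  have hGfst : ∀ i, ∀ p ∈ G i, p.1 ∈ A i := by
    intro i p hp
    obtain ⟨x, rfl⟩ := mem_graphSubalgebra.1 hp
    exact x.2
  have hGindep' : ∀ (s : Finset 𝓛) (x : 𝓛 → 𝔄 × B), (∀ i, x i ∈ G i) →
      (∑ i ∈ s, x i).1 = 0 → ∀ i ∈ s, x i = 0 := fun s x hx h i hi ↦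
    eq_zero_of_mem_graphSubalgebra (hx i) <|
      hindep s (fun i ↦ (x i).1) (fun i ↦ hGfst i _ (hx i)) (by simpa [Prod.fst_sum] using h) i hi
  have hGmul : ∀ i j, ∀ p ∈ G i, ∀ q ∈ G j, p * q ∈ G (i ⊓ j) := by
    intro i j p hp q hq
    obtain ⟨x, rfl⟩ := mem_graphSubalgebra.1 hp
    obtain ⟨y, rfl⟩ := mem_graphSubalgebra.1 hq
    exact mem_graphSubalgebra.2 ⟨⟨x * y, hmul i j x x.2 y y.2⟩, by rw [hψ]; rfl⟩
  have hnorm : ∀ p ∈ componentSpan G Set.univ, ‖p‖ = ‖p.1‖ := by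
    intro p hp
    obtain ⟨F, hF, hp⟩ := exists_finset_of_mem_componentSpan hp
    have hFclosed : IsClosed (componentSubalgebra hGmul hF : Set (𝔄 × B)) :=
      isClosed_componentSpan (fun i ↦ isClosed_graphSubalgebra (hclosed i) (ψ i))
        (fun s x hx h ↦ hGindep' s x hx (by rw [h]; rfl)) hGmul F hF
    let φ : componentSubalgebra hGmul hF →⋆ₙₐ[ℂ] 𝔄 :=
      (NonUnitalStarAlgHom.fst ℂ 𝔄 B).comp (NonUnitalStarSubalgebraClass.subtype _)
    have hφ : Function.Injective φ := by
      rw [injective_iff_map_eq_zero]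
      rintro ⟨q, hq⟩ (h : q.1 = 0)
      obtain ⟨f, hf, rfl⟩ := exists_eq_sum_of_mem_componentSpan (mem_componentSubalgebra.1 hq)
      exact Subtype.ext (Finset.sum_eq_zero (hGindep' F f hf h))
    exact (NonUnitalStarAlgHom.norm_map φ hφ ⟨p, hp⟩).symm
  let T : NonUnitalStarSubalgebra ℂ (𝔄 × B) :=
    (componentSubalgebra hGmul (F := Set.univ) fun _ _ _ _ ↦ trivial).topologicalClosure
  have hT : IsClosed (T : Set (𝔄 × B)) :=
    NonUnitalStarSubalgebra.isClosed_topologicalClosure _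
  have hGT : ∀ (i : 𝓛) (x : A i), ((x : 𝔄), ψ i x) ∈ T := fun i x ↦
    NonUnitalStarSubalgebra.le_topologicalClosure _
      (mem_componentSpan_of_mem (A := G) (Set.mem_univ i) (mem_graphSubalgebra.2 ⟨x, rfl⟩))
  have hTnorm : ∀ p ∈ T, ‖p‖ = ‖p.1‖ := fun p hp ↦
    closure_minimal (t := {p : 𝔄 × B | ‖p‖ = ‖p.1‖}) hnorm
      (isClosed_eq continuous_norm continuous_fst.norm) hp
  let π : T →⋆ₙₐ[ℂ] 𝔄 :=
    (NonUnitalStarAlgHom.fst ℂ 𝔄 B).comp (NonUnitalStarSubalgebraClass.subtype T)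
  have hπ : Function.Injective π := by
    rw [injective_iff_map_eq_zero]
    rintro ⟨q, hq⟩ (h : q.1 = 0)
    have := hTnorm q hq
    rw [h, norm_zero, norm_eq_zero] at this
    exact Subtype.ext this
  have hπsurj : Function.Surjective π := by
    rw [← Set.range_eq_univ, Set.eq_univ_iff_forall]
    have hle : Submodule.span ℂ (⋃ i : 𝓛, (A i : Set 𝔄)) ≤
        (NonUnitalStarAlgHom.range π).toNonUnitalSubalgebra.toSubmodule :=
      Submodule.span_le.2 <| Set.iUnion_subset fun i x hx ↦
        ⟨⟨(x, ψ i ⟨x, hx⟩), hGT i ⟨x, hx⟩⟩, rfl⟩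
    intro x
    exact closure_minimal (t := Set.range π) hle (isClosed_range_of_injective π hπ)
      (htotal ▸ Set.mem_univ x)
  let e : T ≃⋆ₐ[ℂ] 𝔄 := StarAlgEquiv.ofBijective π ⟨hπ, hπsurj⟩
  let Ψ : 𝔄 →⋆ₙₐ[ℂ] B :=
    ((NonUnitalStarAlgHom.snd ℂ 𝔄 B).comp (NonUnitalStarSubalgebraClass.subtype T)).comp
      (e.symm : 𝔄 →⋆ₙₐ[ℂ] T)
  have hΨψ : ∀ (i : 𝓛) (x : A i), Ψ (x : 𝔄) = ψ i x := by
    intro i x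
    have : e.symm (x : 𝔄) = ⟨((x : 𝔄), ψ i x), hGT i x⟩ := by
      rw [← e.injective.eq_iff]
      exact e.apply_symm_apply _
    change ((e.symm (x : 𝔄) : T) : 𝔄 × B).2 = ψ i x
    rw [this]
  refine ⟨Ψ, ⟨map_continuous Ψ, hΨψ⟩, ?_⟩
  rintro Φ ⟨hΦ, hΦψ⟩
  have hdense : Dense (Submodule.span ℂ (⋃ i : 𝓛, (A i : Set 𝔄)) : Set 𝔄) :=
    dense_iff_closure_eq.2 htotal
  refine DFunLike.coe_injective (hΦ.ext_on hdense (map_continuous Ψ) fun x hx ↦ ?_)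
  induction hx using Submodule.span_induction with
  | mem x hx =>
    obtain ⟨i, hx⟩ := Set.mem_iUnion.1 hx
    exact (hΦψ i ⟨x, hx⟩).trans (hΨψ i ⟨x, hx⟩).symm
  | zero => simp
  | add x y _ _ hx hy => rw [map_add, map_add, hx, hy]
  | smul a x _ hx => rw [map_smul, map_smul, hx]

theorem stmt_6
    {𝓛 : Type*} [SemilatticeInf 𝓛]
    {𝔄 : Type*} [NonUnitalNormedRing 𝔄] [StarRing 𝔄] [CStarRing 𝔄]
    [NormedSpace ℂ 𝔄] [IsScalarTower ℂ 𝔄 𝔄] [SMulCommClass ℂ 𝔄 𝔄]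
    [StarModule ℂ 𝔄] [CompleteSpace 𝔄]
    {B : Type*} [NonUnitalNormedRing B] [StarRing B] [CStarRing B]
    [NormedSpace ℂ B] [IsScalarTower ℂ B B] [SMulCommClass ℂ B B]
    [StarModule ℂ B] [CompleteSpace B]
    (A : 𝓛 → NonUnitalStarSubalgebra ℂ 𝔄)
    (hA_closed : ∀ i : 𝓛, IsClosed ((A i : Set 𝔄)))
    (hA_indep : ∀ (s : Finset 𝓛) (x : 𝓛 → 𝔄), (∀ i, x i ∈ A i) →
        ∑ i ∈ s, x i = 0 → ∀ i ∈ s, x i = 0)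
    (hA_total : closure ((Submodule.span ℂ (⋃ i : 𝓛, (A i : Set 𝔄)) : Submodule ℂ 𝔄) : Set 𝔄) = Set.univ)
    (hA_mul : ∀ i j : 𝓛, ∀ x ∈ A i, ∀ y ∈ A j, x * y ∈ A (i ⊓ j))
    (ψ : ∀ i : 𝓛, A i →⋆ₙₐ[ℂ] B)
    (hψ : ∀ (j k : 𝓛) (x : A j) (y : A k),
        ψ (j ⊓ k) ⟨(x : 𝔄) * (y : 𝔄), hA_mul j k (x : 𝔄) x.2 (y : 𝔄) y.2⟩
          = ψ j x * ψ k y) :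
    ∃! Ψ : 𝔄 →⋆ₙₐ[ℂ] B, Continuous Ψ ∧ ∀ (i : 𝓛) (x : A i), Ψ (x : 𝔄) = ψ i x := by
  let _ : NonUnitalCStarAlgebra 𝔄 := {}
  let _ : NonUnitalCStarAlgebra B := {}
  exact existsUnique_starAlgHom_of_graded A hA_closed hA_indep hA_total hA_mul ψ hψ
end

section
/- Let (𝔄,(A_i)_{i∈𝓛}) be an 𝓛-graded C*-algebra, M a finishing sub-semilattice of 𝓛 (a subset closed under ∧ that is upward closed) and M' = 𝓛 \ M its complement. Then there exists a unique continuous *-homomorphism p : 𝔄 → 𝔄 such that p(x) = x for every x ∈ A_i with i ∈ M and p(x) = 0 for every x ∈ A_i with i ∈ M'. Its kernel is the topological closure of 𝔄_{M'} and its range is the topological closure of 𝔄_M. Moreover 𝔄 decomposes as the internal direct sum of these: the closure of 𝔄_{M'} intersects the closure of 𝔄_M in {0}, and their sum is all of 𝔄. -/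
section NormEstimates

variable {𝔄 : Type*} [NonUnitalCStarAlgebra 𝔄]

/-- Elements of a closed *-subalgebra `B` that are congruent modulo a closed ideal `J` of `B + J`
have congruent images under the continuous functional calculus. -/
theorem cfcₙ_add_sub_cfcₙ_mem {B J : NonUnitalStarSubalgebra ℂ 𝔄}
    (hB : IsClosed (B : Set 𝔄)) (hJ : IsClosed (J : Set 𝔄))
    (hBJ : ∀ b ∈ B, ∀ j ∈ J, b * j ∈ J) (hJB : ∀ j ∈ J, ∀ b ∈ B, j * b ∈ J)
    {f : ℝ → ℝ} (hf : Continuous f) {b j : 𝔄} (hb : b ∈ B) (hj : j ∈ J)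
    (hb' : IsSelfAdjoint b) (hj' : IsSelfAdjoint j) :
    cfcₙ f b ∈ B ∧ cfcₙ f (b + j) - cfcₙ f b ∈ J := by
  let S : NonUnitalStarSubalgebra ℂ (𝔄 × 𝔄) :=
    { carrier := {z | z.2 ∈ B ∧ z.1 - z.2 ∈ J}
      add_mem' := by
        rintro ⟨x, y⟩ ⟨u, v⟩ ⟨hy, hxy⟩ ⟨hv, huv⟩
        refine ⟨add_mem hy hv, ?_⟩
        simpa [add_sub_add_comm] using add_mem hxy huv
      zero_mem' := by simp
      smul_mem' := by
        rintro c ⟨x, y⟩ ⟨hy, hxy⟩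
        refine ⟨SMulMemClass.smul_mem c hy, ?_⟩
        simpa [smul_sub] using SMulMemClass.smul_mem c hxy
      mul_mem' := by
        rintro ⟨x, y⟩ ⟨u, v⟩ ⟨hy, hxy⟩ ⟨hv, huv⟩
        dsimp only at hy hxy hv huv
        refine ⟨mul_mem hy hv, ?_⟩
        have h := add_mem (add_mem (mul_mem hxy huv) (hBJ _ hy _ huv)) (hJB _ hxy _ hv)
        convert h using 1
        simp only [Prod.mk_mul_mk]
        noncomm_ring
      star_mem' := by
        rintro ⟨x, y⟩ ⟨hy, hxy⟩
        refine ⟨star_mem hy, ?_⟩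
        simpa using star_mem hxy }
  have hS : IsClosed (S : Set (𝔄 × 𝔄)) :=
    (hB.preimage continuous_snd).inter (hJ.preimage (continuous_fst.sub continuous_snd))
  have hsum : IsSelfAdjoint (b + j) := hb'.add hj'
  have hpair : IsSelfAdjoint ((b + j, b) : 𝔄 × 𝔄) := Prod.ext hsum hb'
  have hmem : ((b + j, b) : 𝔄 × 𝔄) ∈ S := ⟨hb, by simpa using hj⟩
  have key : cfcₙ f ((b + j, b) : 𝔄 × 𝔄) ∈ S := cfcₙ_mem (𝕜' := ℂ) f hmem
  rw [cfcₙ_map_prod (S := ℂ) f (b + j) b hf.continuousOn hpair hsum hb'] at key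
  exact key

/-- A closed *-subalgebra `B` meeting a closed ideal `J` of `B + J` trivially is the range of a
contractive projection along `J`, on self-adjoint elements. -/
theorem IsSelfAdjoint.norm_le_norm_add_of_disjoint {B J : NonUnitalStarSubalgebra ℂ 𝔄}
    (hB : IsClosed (B : Set 𝔄)) (hJ : IsClosed (J : Set 𝔄))
    (hBJ : ∀ b ∈ B, ∀ j ∈ J, b * j ∈ J) (hJB : ∀ j ∈ J, ∀ b ∈ B, j * b ∈ J)
    (hdisj : ∀ x ∈ B, x ∈ J → x = 0) {b j : 𝔄} (hb : b ∈ B) (hj : j ∈ J)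
    (hb' : IsSelfAdjoint b) (hj' : IsSelfAdjoint j) : ‖b‖ ≤ ‖b + j‖ := by
  have hsum : IsSelfAdjoint (b + j) := hb'.add hj'
  set c := ‖b + j‖ with hc
  have hc0 : 0 ≤ c := norm_nonneg _
  let f : ℝ → ℝ := fun t ↦ max (|t| - c) 0
  have hf : Continuous f := by fun_prop
  have hf0 : f 0 = 0 := by simp [f, hc0]
  obtain ⟨h₁, h₂⟩ := cfcₙ_add_sub_cfcₙ_mem hB hJ hBJ hJB hf hb hj hb' hj'
  have hzero : cfcₙ f (b + j) = 0 := by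
    rw [← norm_le_zero_iff]
    refine norm_cfcₙ_le fun x hx ↦ ?_
    have hx' : |x| ≤ c := by
      have := norm_apply_le_norm_cfcₙ (id : ℝ → ℝ) (b + j) hx
      rwa [cfcₙ_id ℝ (b + j)] at this
    simp [f, hx']
  have hfb : cfcₙ f b = 0 := by
    refine hdisj _ h₁ ?_
    rw [hzero, zero_sub] at h₂
    simpa using h₂
  have hbound : ∀ x ∈ quasispectrum ℝ b, ‖(id : ℝ → ℝ) x‖ ≤ c := by
    intro x hx
    have := norm_apply_le_norm_cfcₙ f b hx hf.continuousOn hf0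
    rw [hfb, norm_zero, norm_le_zero_iff] at this
    have h := (le_max_left (|x| - c) 0).trans_eq this
    simpa using h
  have := norm_cfcₙ_le hbound
  rwa [cfcₙ_id ℝ b] at this

/-- A closed *-subalgebra `B` meeting a closed ideal `J` of `B + J` trivially is the range of a
contractive projection along `J`. -/
theorem norm_le_norm_add_of_disjoint {B J : NonUnitalStarSubalgebra ℂ 𝔄}
    (hB : IsClosed (B : Set 𝔄)) (hJ : IsClosed (J : Set 𝔄))
    (hBJ : ∀ b ∈ B, ∀ j ∈ J, b * j ∈ J) (hJB : ∀ j ∈ J, ∀ b ∈ B, j * b ∈ J)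
    (hdisj : ∀ x ∈ B, x ∈ J → x = 0) {b j : 𝔄} (hb : b ∈ B) (hj : j ∈ J) :
    ‖b‖ ≤ ‖b + j‖ := by
  have hexp : star (b + j) * (b + j) =
      star b * b + (star b * j + star j * b + star j * j) := by
    rw [star_add]; noncomm_ring
  have hmem : star b * j + star j * b + star j * j ∈ J :=
    add_mem (add_mem (hBJ _ (star_mem hb) _ hj) (hJB _ (star_mem hj) _ hb))
      (mul_mem (star_mem hj) hj)
  have hsa : IsSelfAdjoint (star b * j + star j * b + star j * j) := by
    rw [isSelfAdjoint_iff]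
    simp only [star_add, star_mul, star_star]
    abel
  have h := IsSelfAdjoint.norm_le_norm_add_of_disjoint hB hJ hBJ hJB hdisj
    (mul_mem (star_mem hb) hb) hmem (.star_mul_self b) hsa
  rw [← hexp, CStarRing.norm_star_mul_self, CStarRing.norm_star_mul_self] at h
  exact (mul_self_le_mul_self_iff (norm_nonneg _) (norm_nonneg _)).mpr h

end NormEstimates

/-- If a closed subspace `p` is the range of a contractive projection along a closed subspace `q`,
then `p ⊔ q` is closed. -/
theorem Submodule.isClosed_sup_of_norm_le {E : Type*} [NormedAddCommGroup E] [NormedSpace ℂ E]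
    [CompleteSpace E] {p q : Submodule ℂ E} (hp : IsClosed (p : Set E)) (hq : IsClosed (q : Set E))
    (h : ∀ x ∈ p, ∀ y ∈ q, ‖x‖ ≤ ‖x + y‖) : IsClosed ((p ⊔ q : Submodule ℂ E) : Set E) := by
  have := hp.completeSpace_coe
  have := hq.completeSpace_coe
  let T : p × q →L[ℂ] E := p.subtypeL.coprod q.subtypeL
  have hT : AntilipschitzWith 2 T := by
    refine ContinuousLinearMap.antilipschitz_of_bound T fun ⟨x, y⟩ ↦ ?_
    have h₁ : ‖(x : E)‖ ≤ ‖(x : E) + y‖ := h x x.2 y y.2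
    have h₂ : ‖(y : E)‖ ≤ ‖(x : E) + y‖ + ‖(x : E)‖ := by
      simpa using norm_sub_le ((x : E) + y) (x : E)
    change max ‖(x : E)‖ ‖(y : E)‖ ≤ 2 * ‖(x : E) + y‖
    exact max_le (by linarith [norm_nonneg ((x : E) + y)]) (by linarith)
  have hr : Set.range T = ((p ⊔ q : Submodule ℂ E) : Set E) := by
    ext z
    simp [T, Submodule.mem_sup]
  exact hr ▸ hT.isClosed_range T.uniformContinuous

section GradedPart

variable {𝓛 : Type*} {𝔄 : Type*} [NonUnitalCStarAlgebra 𝔄]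

/-- The linear span of the components indexed by `S`. -/
def gradedSpan (A : 𝓛 → NonUnitalStarSubalgebra ℂ 𝔄) (S : Set 𝓛) : Submodule ℂ 𝔄 :=
  ⨆ i ∈ S, (A i).toSubmodule

variable {A : 𝓛 → NonUnitalStarSubalgebra ℂ 𝔄}

theorem gradedSpan_eq_span (S : Set 𝓛) :
    gradedSpan A S = Submodule.span ℂ (⋃ i ∈ S, (A i : Set 𝔄)) := by
  rw [Submodule.span_iUnion₂]
  exact iSup_congr fun i ↦ iSup_congr fun _ ↦ (Submodule.span_eq (A i).toSubmodule).symm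

theorem mem_gradedSpan_of_mem {S : Set 𝓛} {i : 𝓛} (hi : i ∈ S) {x : 𝔄} (hx : x ∈ A i) :
    x ∈ gradedSpan A S :=
  Submodule.mem_iSup_of_mem i (Submodule.mem_iSup_of_mem hi hx)

theorem gradedSpan_mono {S T : Set 𝓛} (h : S ⊆ T) : gradedSpan A S ≤ gradedSpan A T :=
  biSup_mono h

@[elab_as_elim]
theorem gradedSpan_induction {S : Set 𝓛} {motive : 𝔄 → Prop} {x : 𝔄} (hx : x ∈ gradedSpan A S)
    (mem : ∀ i ∈ S, ∀ x ∈ A i, motive x) (zero : motive 0)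
    (add : ∀ x y, motive x → motive y → motive (x + y)) : motive x :=
  Submodule.iSup_induction _ (motive := motive) hx
    (fun i _ hy ↦ Submodule.iSup_induction _ (motive := motive) hy (fun hi ↦ mem i hi) zero add)
    zero add

theorem exists_finite_mem_gradedSpan {S : Set 𝓛} {x : 𝔄} (hx : x ∈ gradedSpan A S) :
    ∃ T ⊆ S, T.Finite ∧ x ∈ gradedSpan A T := by
  refine gradedSpan_induction hx
    (fun i hi x hx ↦ ⟨{i}, Set.singleton_subset_iff.mpr hi, Set.finite_singleton i,
      mem_gradedSpan_of_mem (Set.mem_singleton i) hx⟩)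
    ⟨∅, Set.empty_subset _, Set.finite_empty, zero_mem _⟩ ?_
  rintro x y ⟨T, hTS, hT, hx⟩ ⟨U, hUS, hU, hy⟩
  exact ⟨T ∪ U, Set.union_subset hTS hUS, hT.union hU,
    add_mem (gradedSpan_mono Set.subset_union_left hx) (gradedSpan_mono Set.subset_union_right hy)⟩

theorem star_mem_gradedSpan {S : Set 𝓛} {x : 𝔄} (hx : x ∈ gradedSpan A S) :
    star x ∈ gradedSpan A S := by
  refine gradedSpan_induction hx (fun i hi x hx ↦ mem_gradedSpan_of_mem hi (star_mem hx))
    (by simp) fun u v hu hv ↦ ?_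
  rw [star_add]
  exact add_mem hu hv

theorem disjoint_gradedSpan
    (hindep : ∀ (s : Finset 𝓛) (x : 𝓛 → 𝔄), (∀ i, x i ∈ A i) →
      ∑ i ∈ s, x i = 0 → ∀ i ∈ s, x i = 0)
    {S T : Set 𝓛} (hST : Disjoint S T) (hS : S.Finite) :
    Disjoint (gradedSpan A S) (gradedSpan A T) := by
  classical
  refine iSupIndep.disjoint_biSup_biSup' ?_ hST hS
  rw [iSupIndep_iff_finsetSum_eq_zero_imp_eq_zero]
  intro s v hv hsum i hi
  have h := hindep s (fun i ↦ if i ∈ s then v i else 0) (fun i ↦ ?_) ?_ i hi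
  · simpa [hi] using h
  · split_ifs with h
    · exact hv i h
    · exact zero_mem _
  · rw [← hsum]
    exact Finset.sum_congr rfl fun i hi ↦ if_pos hi

variable [SemilatticeInf 𝓛]

theorem mul_mem_gradedSpan (hmul : ∀ i j : 𝓛, ∀ x ∈ A i, ∀ y ∈ A j, x * y ∈ A (i ⊓ j))
    {S T U : Set 𝓛} (h : ∀ i ∈ S, ∀ j ∈ T, i ⊓ j ∈ U) {x y : 𝔄} (hx : x ∈ gradedSpan A S)
    (hy : y ∈ gradedSpan A T) : x * y ∈ gradedSpan A U := by
  refine gradedSpan_induction hx (fun i hi x hx ↦ ?_) (by simp) fun u v hu hv ↦ ?_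
  · refine gradedSpan_induction hy
      (fun j hj y hy ↦ mem_gradedSpan_of_mem (h i hi j hj) (hmul i j x hx y hy)) (by simp)
      fun u v hu hv ↦ ?_
    rw [mul_add]
    exact add_mem hu hv
  · rw [add_mul]
    exact add_mem hu hv

/-- The linear span of the components indexed by a sub-semilattice is a *-subalgebra. -/
def gradedSubalgebra (hmul : ∀ i j : 𝓛, ∀ x ∈ A i, ∀ y ∈ A j, x * y ∈ A (i ⊓ j))
    (S : Set 𝓛) (hS : InfClosed S) : NonUnitalStarSubalgebra ℂ 𝔄 :=
  { gradedSpan A S with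
    mul_mem' := mul_mem_gradedSpan hmul fun _ hi _ hj ↦ hS hi hj
    star_mem' := star_mem_gradedSpan }

theorem norm_le_norm_add_of_isClosed_gradedSpan
    (hmul : ∀ i j : 𝓛, ∀ x ∈ A i, ∀ y ∈ A j, x * y ∈ A (i ⊓ j))
    (hindep : ∀ (s : Finset 𝓛) (x : 𝓛 → 𝔄), (∀ i, x i ∈ A i) →
      ∑ i ∈ s, x i = 0 → ∀ i ∈ s, x i = 0)
    {S T : Set 𝓛} (hST : Disjoint S T) (hfin : S.Finite) (hS : InfClosed S) (hT : InfClosed T)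
    (hidl : ∀ i ∈ S, ∀ j ∈ T, i ⊓ j ∈ T)
    (hScl : IsClosed (gradedSpan A S : Set 𝔄)) (hTcl : IsClosed (gradedSpan A T : Set 𝔄)) :
    ∀ x ∈ gradedSpan A S, ∀ y ∈ gradedSpan A T, ‖x‖ ≤ ‖x + y‖ := fun _ hx _ hy ↦
  norm_le_norm_add_of_disjoint (B := gradedSubalgebra hmul S hS) (J := gradedSubalgebra hmul T hT)
    hScl hTcl (fun _ hb _ hj ↦ mul_mem_gradedSpan hmul hidl hb hj)
    (fun _ hj _ hb ↦ mul_mem_gradedSpan hmul (fun i hi j hj ↦ inf_comm i j ▸ hidl j hj i hi) hj hb)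
    (Submodule.disjoint_def.mp (disjoint_gradedSpan hindep hST hfin)) hx hy

theorem isClosed_gradedSpan_of_finite (hclosed : ∀ i : 𝓛, IsClosed (A i : Set 𝔄))
    (hmul : ∀ i j : 𝓛, ∀ x ∈ A i, ∀ y ∈ A j, x * y ∈ A (i ⊓ j))
    (hindep : ∀ (s : Finset 𝓛) (x : 𝓛 → 𝔄), (∀ i, x i ∈ A i) →
      ∑ i ∈ s, x i = 0 → ∀ i ∈ s, x i = 0)
    (F : Finset 𝓛) (hF : InfClosed (F : Set 𝓛)) : IsClosed (gradedSpan A F : Set 𝔄) := by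
  classical
  induction F using Finset.strongInduction with
  | H F ih =>
    rcases F.eq_empty_or_nonempty with rfl | hne
    · simp [gradedSpan]
    obtain ⟨m, hm⟩ := F.exists_maximal hne
    have hinf : ∀ i ∈ F, ∀ j ∈ F, j ≠ m → i ⊓ j ≠ m := fun i _ j hj hjm h ↦
      hjm (hm.eq_of_ge hj (h ▸ inf_le_right))
    have hsingle : gradedSpan A {m} = (A m).toSubmodule := by simp [gradedSpan]
    have hsingle_cl : IsClosed (gradedSpan A {m} : Set 𝔄) := hsingle ▸ hclosed m
    have herase : InfClosed (F.erase m : Set 𝓛) := fun i hi j hj ↦ by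
      simp only [Finset.coe_erase, Set.mem_sdiff, Finset.mem_coe, Set.mem_singleton_iff] at hi hj ⊢
      exact ⟨hF hi.1 hj.1, hinf i hi.1 j hj.1 hj.2⟩
    have herase_cl := ih (F.erase m) (F.erase_ssubset hm.prop) herase
    have hunion : gradedSpan A (F : Set 𝓛) = gradedSpan A {m} ⊔ gradedSpan A (F.erase m) := by
      rw [gradedSpan, gradedSpan, gradedSpan, ← iSup_union, Set.singleton_union,
        ← Finset.coe_insert, Finset.insert_erase hm.prop]
    rw [hunion]
    refine Submodule.isClosed_sup_of_norm_le hsingle_cl herase_cl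
      (norm_le_norm_add_of_isClosed_gradedSpan hmul hindep (by simp) (Set.finite_singleton m)
        infClosed_singleton herase ?_ hsingle_cl herase_cl)
    rintro _ rfl j hj
    simp only [Finset.coe_erase, Set.mem_sdiff, Finset.mem_coe, Set.mem_singleton_iff] at hj ⊢
    exact ⟨hF hm.prop hj.1, hinf _ hm.prop j hj.1 hj.2⟩

theorem norm_le_norm_add_gradedSpan_compl (hclosed : ∀ i : 𝓛, IsClosed (A i : Set 𝔄))
    (hmul : ∀ i j : 𝓛, ∀ x ∈ A i, ∀ y ∈ A j, x * y ∈ A (i ⊓ j))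
    (hindep : ∀ (s : Finset 𝓛) (x : 𝓛 → 𝔄), (∀ i, x i ∈ A i) →
      ∑ i ∈ s, x i = 0 → ∀ i ∈ s, x i = 0)
    {M : Set 𝓛} (hM : InfClosed M) (hup : IsUpperSet M) {x y : 𝔄}
    (hx : x ∈ gradedSpan A M) (hy : y ∈ gradedSpan A Mᶜ) : ‖x‖ ≤ ‖x + y‖ := by
  obtain ⟨S, hSM, hS, hx⟩ := exists_finite_mem_gradedSpan hx
  obtain ⟨T, hTM, hT, hy⟩ := exists_finite_mem_gradedSpan hy
  have hlow : IsLowerSet Mᶜ := hup.compl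
  have hlow_inf : ∀ i : 𝓛, ∀ j ∈ Mᶜ, i ⊓ j ∈ Mᶜ := fun i j hj ↦ hlow inf_le_right hj
  set F := infClosure (S ∪ T)
  have hFfin : F.Finite := (hS.union hT).infClosure
  have hF : InfClosed F := infClosed_infClosure
  have hsub : S ∪ T ⊆ F := subset_infClosure
  have hclosed_fin : ∀ U : Set 𝓛, U.Finite → InfClosed U → IsClosed (gradedSpan A U : Set 𝔄) := by
    intro U hU hinf
    lift U to Finset 𝓛 using hU
    exact isClosed_gradedSpan_of_finite hclosed hmul hindep U hinf
  have h₁ : InfClosed (F ∩ M) := hF.inter hM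
  have h₂ : InfClosed (F ∩ Mᶜ) := hF.inter fun i _ j hj ↦ hlow_inf i j hj
  have hfin₁ : (F ∩ M).Finite := hFfin.inter_of_left M
  have hfin₂ : (F ∩ Mᶜ).Finite := hFfin.inter_of_left Mᶜ
  exact norm_le_norm_add_of_isClosed_gradedSpan hmul hindep
    (disjoint_compl_right.mono Set.inter_subset_right Set.inter_subset_right) hfin₁ h₁ h₂
    (fun i hi j hj ↦ ⟨hF hi.1 hj.1, hlow_inf i j hj.2⟩)
    (hclosed_fin _ hfin₁ h₁) (hclosed_fin _ hfin₂ h₂)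
    x (gradedSpan_mono (Set.subset_inter (Set.subset_union_left.trans hsub) hSM) hx)
    y (gradedSpan_mono (Set.subset_inter (Set.subset_union_right.trans hsub) hTM) hy)

end GradedPart

/-- The projection onto a *-subalgebra `B` along a complementary ideal `J`, as a
*-homomorphism. -/
noncomputable def NonUnitalStarAlgHom.projectionAlongIdeal {𝔄 : Type*} [NonUnitalCStarAlgebra 𝔄]
    (B : NonUnitalStarSubalgebra ℂ 𝔄) (J : Submodule ℂ 𝔄) (h : IsCompl B.toSubmodule J)
    (hBJ : ∀ b ∈ B, ∀ j ∈ J, b * j ∈ J) (hJ : ∀ j ∈ J, ∀ x, j * x ∈ J)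
    (hstar : ∀ j ∈ J, star j ∈ J) : 𝔄 →⋆ₙₐ[ℂ] 𝔄 :=
  have hker (x : 𝔄) : x - B.toSubmodule.projection J h x ∈ J := by
    rw [← Submodule.projection_apply_eq_zero_iff h, map_sub, sub_eq_zero]
    exact (Submodule.projection_apply_of_mem_left h (Submodule.projection_apply_mem h x)).symm
  have heq {x y : 𝔄} (hy : y ∈ B) (hxy : x - y ∈ J) : B.toSubmodule.projection J h x = y := by
    rw [← Submodule.projection_apply_of_mem_left h hy, ← sub_eq_zero, ← map_sub]
    exact (Submodule.projection_apply_eq_zero_iff h).mpr hxy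
  { B.toSubmodule.projection J h with
    map_zero' := map_zero (B.toSubmodule.projection J h)
    map_mul' := fun x y ↦ by
      refine heq (mul_mem (Submodule.projection_apply_mem h x)
        (Submodule.projection_apply_mem h y)) ?_
      have := add_mem (hJ _ (hker x) y) (hBJ _ (Submodule.projection_apply_mem h x) _ (hker y))
      convert this using 1
      noncomm_ring
    map_star' := fun x ↦ by
      refine heq (star_mem (Submodule.projection_apply_mem h x)) ?_
      rw [← star_sub]
      exact hstar _ (hker x) }


theorem stmt_7
    {𝓛 : Type*} [SemilatticeInf 𝓛]
    {𝔄 : Type*} [NonUnitalNormedRing 𝔄] [StarRing 𝔄] [CStarRing 𝔄]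
    [NormedSpace ℂ 𝔄] [IsScalarTower ℂ 𝔄 𝔄] [SMulCommClass ℂ 𝔄 𝔄]
    [StarModule ℂ 𝔄] [CompleteSpace 𝔄]
    (A : 𝓛 → NonUnitalStarSubalgebra ℂ 𝔄)
    (hA_closed : ∀ i : 𝓛, IsClosed ((A i : Set 𝔄)))
    (hA_indep : ∀ (s : Finset 𝓛) (x : 𝓛 → 𝔄), (∀ i, x i ∈ A i) →
        ∑ i ∈ s, x i = 0 → ∀ i ∈ s, x i = 0)
    (hA_total : closure ((Submodule.span ℂ (⋃ i : 𝓛, (A i : Set 𝔄)) : Submodule ℂ 𝔄) : Set 𝔄) = Set.univ)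
    (hA_mul : ∀ i j : 𝓛, ∀ x ∈ A i, ∀ y ∈ A j, x * y ∈ A (i ⊓ j))
    (M : Set 𝓛)
    (hM_inf : ∀ i ∈ M, ∀ j ∈ M, i ⊓ j ∈ M)
    (hM_up : ∀ a ∈ M, ∀ b, a ≤ b → b ∈ M)
    (SM SM' : Set 𝔄)
    (hSM : SM = closure ((Submodule.span ℂ (⋃ i ∈ M, (A i : Set 𝔄)) : Submodule ℂ 𝔄) : Set 𝔄))
    (hSM' : SM' = closure ((Submodule.span ℂ (⋃ i ∈ Mᶜ, (A i : Set 𝔄)) : Submodule ℂ 𝔄) : Set 𝔄)) :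
    ∃ p : 𝔄 →⋆ₙₐ[ℂ] 𝔄, Continuous p ∧
      (∀ i ∈ M, ∀ x ∈ A i, p x = x) ∧ (∀ i : 𝓛, i ∉ M → ∀ x ∈ A i, p x = 0) ∧
      (∀ q : 𝔄 →⋆ₙₐ[ℂ] 𝔄, Continuous q → (∀ i ∈ M, ∀ x ∈ A i, q x = x) →
        (∀ i : 𝓛, i ∉ M → ∀ x ∈ A i, q x = 0) → q = p) ∧
      {x : 𝔄 | p x = 0} = SM' ∧ Set.range p = SM ∧
      SM' ∩ SM = {0} ∧ (∀ a : 𝔄, ∃ x ∈ SM', ∃ y ∈ SM, a = x + y) := by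
  let _ : NonUnitalCStarAlgebra 𝔄 := {}
  have hM : InfClosed M := fun i hi j hj ↦ hM_inf i hi j hj
  have hup : IsUpperSet M := fun a b hab ha ↦ hM_up a ha b hab
  have hlow_inf : ∀ i : 𝓛, ∀ j ∈ Mᶜ, i ⊓ j ∈ Mᶜ := fun i j hj ↦ hup.compl inf_le_right hj
  let B := (gradedSubalgebra hA_mul M hM).topologicalClosure
  let J := (gradedSpan A Mᶜ).topologicalClosure
  have hBcoe : (B : Set 𝔄) = SM := by rw [hSM, ← gradedSpan_eq_span]; rfl
  have hJcoe : (J : Set 𝔄) = SM' := by rw [hSM', ← gradedSpan_eq_span]; rfl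
  have hBcl : IsClosed (B : Set 𝔄) := isClosed_closure
  have hJcl : IsClosed (J : Set 𝔄) := isClosed_closure
  have hle : ∀ x ∈ B, ∀ y ∈ J, ‖x‖ ≤ ‖x + y‖ := by
    intro x hx y hy
    have hxy : (x, y) ∈ closure ((gradedSpan A M : Set 𝔄) ×ˢ (gradedSpan A Mᶜ : Set 𝔄)) := by
      rw [closure_prod_eq]
      exact ⟨hx, hy⟩
    refine closure_minimal (t := {z : 𝔄 × 𝔄 | ‖z.1‖ ≤ ‖z.1 + z.2‖}) ?_
      (isClosed_le (by fun_prop) (by fun_prop)) hxy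
    rintro ⟨u, v⟩ ⟨hu, hv⟩
    exact norm_le_norm_add_gradedSpan_compl hA_closed hA_mul hA_indep hM hup hu hv
  have hmemB : ∀ i ∈ M, ∀ x ∈ A i, x ∈ B := fun i hi x hx ↦
    subset_closure (mem_gradedSpan_of_mem hi hx)
  have hmemJ : ∀ i ∈ Mᶜ, ∀ x ∈ A i, x ∈ J := fun i hi x hx ↦
    subset_closure (mem_gradedSpan_of_mem hi hx)
  have hdisj : Disjoint B.toSubmodule J := by
    refine Submodule.disjoint_def.mpr fun x hx hx' ↦ ?_
    simpa using hle x hx (-x) (neg_mem hx')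
  have hspan : Submodule.span ℂ (⋃ i : 𝓛, (A i : Set 𝔄)) ≤ B.toSubmodule ⊔ J := by
    refine Submodule.span_le.mpr (Set.iUnion_subset fun i x hx ↦ ?_)
    by_cases hi : i ∈ M
    · exact Submodule.mem_sup_left (hmemB i hi x hx)
    · exact Submodule.mem_sup_right (hmemJ i hi x hx)
  have hcompl : IsCompl B.toSubmodule J := by
    refine ⟨hdisj, codisjoint_iff.mpr (eq_top_iff.mpr fun x _ ↦ ?_)⟩
    have hx : x ∈ closure ((Submodule.span ℂ (⋃ i : 𝓛, (A i : Set 𝔄)) : Submodule ℂ 𝔄) : Set 𝔄) :=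
      hA_total ▸ Set.mem_univ x
    exact closure_minimal hspan (Submodule.isClosed_sup_of_norm_le hBcl hJcl hle) hx
  have hBJ : ∀ b ∈ B, ∀ j ∈ J, b * j ∈ J := fun b hb j hj ↦
    map_mem_closure₂ continuous_mul hb hj fun _ hu _ hv ↦
      mul_mem_gradedSpan hA_mul (fun i _ j hj ↦ hlow_inf i j hj) hu hv
  have hJB : ∀ j ∈ J, ∀ b ∈ B, j * b ∈ J := fun j hj b hb ↦
    map_mem_closure₂ continuous_mul hj hb fun _ hu _ hv ↦
      mul_mem_gradedSpan hA_mul (fun i hi j _ ↦ inf_comm i j ▸ hlow_inf j i hi) hu hv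
  have hJJ : ∀ j ∈ J, ∀ k ∈ J, j * k ∈ J := fun j hj k hk ↦
    map_mem_closure₂ continuous_mul hj hk fun _ hu _ hv ↦
      mul_mem_gradedSpan hA_mul (fun i _ j hj ↦ hlow_inf i j hj) hu hv
  have hstar : ∀ j ∈ J, star j ∈ J := fun j hj ↦
    map_mem_closure continuous_star hj fun _ hu ↦ star_mem_gradedSpan hu
  have hdecomp : ∀ x : 𝔄, ∃ b ∈ B, ∃ j ∈ J, b + j = x := fun x ↦
    Submodule.mem_sup.mp (hcompl.sup_eq_top ▸ Submodule.mem_top)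
  have hJr : ∀ j ∈ J, ∀ x, j * x ∈ J := fun j hj x ↦ by
    obtain ⟨b, hb, k, hk, rfl⟩ := hdecomp x
    rw [mul_add]
    exact add_mem (hJB j hj b hb) (hJJ j hj k hk)
  let p := NonUnitalStarAlgHom.projectionAlongIdeal B J hcompl hBJ hJr hstar
  have hpB : ∀ x ∈ B, p x = x := fun x hx ↦ Submodule.projection_apply_of_mem_left hcompl hx
  have hpJ : ∀ x, p x = 0 ↔ x ∈ J := fun x ↦ Submodule.projection_apply_eq_zero_iff hcompl
  have hpc : Continuous p := by
    refine AddMonoidHomClass.continuous_of_bound p 1 fun x ↦ ?_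
    obtain ⟨b, hb, j, hj, rfl⟩ := hdecomp x
    rw [map_add, hpB b hb, (hpJ j).mpr hj, add_zero, one_mul]
    exact hle b hb j hj
  refine ⟨p, hpc, fun i hi x hx ↦ hpB x (hmemB i hi x hx),
    fun i hi x hx ↦ (hpJ x).mpr (hmemJ i hi x hx), ?_, ?_, ?_, ?_, ?_⟩
  · intro q hq hqM hqM'
    have hEq : Set.EqOn q p (⋃ i : 𝓛, (A i : Set 𝔄)) := by
      intro x hx
      obtain ⟨i, hx⟩ := Set.mem_iUnion.mp hx
      by_cases hi : i ∈ M
      · rw [hqM i hi x hx, hpB x (hmemB i hi x hx)]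
      · rw [hqM' i hi x hx, (hpJ x).mpr (hmemJ i hi x hx)]
    have hspanEq : Set.EqOn q p
        ((Submodule.span ℂ (⋃ i : 𝓛, (A i : Set 𝔄)) : Submodule ℂ 𝔄) : Set 𝔄) := by
      intro x hx
      exact LinearMap.eqOn_span (f := (q : 𝔄 →ₗ[ℂ] 𝔄)) (g := (p : 𝔄 →ₗ[ℂ] 𝔄)) hEq hx
    exact DFunLike.coe_injective
      (Continuous.ext_on (dense_iff_closure_eq.mpr hA_total) hq hpc hspanEq)
  · rw [← hJcoe]
    exact Set.ext hpJ
  · rw [← hBcoe]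
    ext x
    refine ⟨?_, fun hx ↦ ⟨x, hpB x hx⟩⟩
    rintro ⟨y, rfl⟩
    exact Submodule.projection_apply_mem hcompl y
  · rw [← hBcoe, ← hJcoe]
    refine Set.eq_singleton_iff_unique_mem.mpr ⟨⟨zero_mem J, zero_mem B⟩, fun x hx ↦ ?_⟩
    exact Submodule.disjoint_def.mp hdisj x hx.2 hx.1
  · intro a
    obtain ⟨b, hb, j, hj, rfl⟩ := hdecomp a
    exact ⟨j, hJcoe ▸ hj, b, hBcoe ▸ hb, add_comm b j⟩
end

section
/- Let 𝓛 be a meet-semilattice, 𝔄 a C*-algebra, and (A_i)_{i∈𝓛}, (B_i)_{i∈𝓛} two families of closed *-subalgebras of 𝔄 such that: the family (A_i) is total (the closed linear span of ⋃_i A_i is 𝔄), the family (B_i) is linearly independent, A_i · A_j ⊆ A_{i∧j} and B_i · B_j ⊆ B_{i∧j} for all i, j ∈ 𝓛, and A_i ⊆ B_i for all i ∈ 𝓛. Then both families are 𝓛-gradings of 𝔄, and A_i = B_i for every i ∈ 𝓛. -/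
/-- The odd function `t ↦ t - clamp t`, where `clamp` truncates to `[-ε, ε]`. -/
def softThreshold (ε t : ℝ) : ℝ := t - max (-ε) (min t ε)

lemma continuous_softThreshold (ε : ℝ) : Continuous (softThreshold ε) := by
  unfold softThreshold; fun_prop

lemma softThreshold_zero {ε : ℝ} (hε : 0 ≤ ε) : softThreshold ε 0 = 0 := by
  simp [softThreshold, hε]

section CStar

variable {𝔄 : Type*} [NonUnitalCStarAlgebra 𝔄]

lemma cfcₙ_softThreshold_eq_zero {ε : ℝ} {a : 𝔄} (ha : IsSelfAdjoint a) (h : ‖a‖ ≤ ε) :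
    cfcₙ (softThreshold ε) a = 0 := by
  rw [← cfcₙ_zero ℝ a]
  refine cfcₙ_congr fun t ht ↦ ?_
  have h1 : ‖t‖ ≤ ‖a‖ := by
    simpa [cfcₙ_id' ℝ a] using norm_apply_le_norm_cfcₙ (fun t : ℝ ↦ t) a ht
  have h2 := abs_le.mp ((Real.norm_eq_abs t ▸ h1).trans h)
  simp [softThreshold, min_eq_left h2.2, max_eq_right h2.1]

lemma norm_sub_cfcₙ_softThreshold_le {ε : ℝ} (hε : 0 ≤ ε) {a : 𝔄} (ha : IsSelfAdjoint a) :
    ‖a - cfcₙ (softThreshold ε) a‖ ≤ ε := by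
  have h : a - cfcₙ (softThreshold ε) a = cfcₙ (fun t : ℝ ↦ t - softThreshold ε t) a := by
    rw [cfcₙ_sub (fun t : ℝ ↦ t) (softThreshold ε) a (by fun_prop) rfl
      (continuous_softThreshold ε).continuousOn (softThreshold_zero hε), cfcₙ_id' ℝ a]
  rw [h]
  refine norm_cfcₙ_le fun t _ ↦ ?_
  rw [Real.norm_eq_abs, abs_le]
  have : t - softThreshold ε t = max (-ε) (min t ε) := by simp [softThreshold]
  rw [this]
  exact ⟨le_max_left _ _, max_le (by linarith) (min_le_right _ _)⟩

/-- The pairs of elements of the idealizer of `I` which agree modulo `I`. -/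
def congruentPairs (I : NonUnitalStarSubalgebra ℂ 𝔄) : NonUnitalStarSubalgebra ℂ (𝔄 × 𝔄) where
  carrier := {p | p.1 - p.2 ∈ I ∧ (∀ x ∈ I, p.1 * x ∈ I) ∧ (∀ x ∈ I, x * p.1 ∈ I) ∧
    (∀ x ∈ I, p.2 * x ∈ I) ∧ ∀ x ∈ I, x * p.2 ∈ I}
  add_mem' := by
    rintro p q ⟨h1, h2, h3, h4, h5⟩ ⟨k1, k2, k3, k4, k5⟩
    refine ⟨?_, fun x hx ↦ ?_, fun x hx ↦ ?_, fun x hx ↦ ?_, fun x hx ↦ ?_⟩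
    · simpa [add_sub_add_comm] using add_mem h1 k1
    · simpa [add_mul] using add_mem (h2 x hx) (k2 x hx)
    · simpa [mul_add] using add_mem (h3 x hx) (k3 x hx)
    · simpa [add_mul] using add_mem (h4 x hx) (k4 x hx)
    · simpa [mul_add] using add_mem (h5 x hx) (k5 x hx)
  zero_mem' := by simp
  mul_mem' := by
    rintro p q ⟨h1, h2, h3, h4, h5⟩ ⟨k1, k2, k3, k4, k5⟩
    refine ⟨?_, fun x hx ↦ ?_, fun x hx ↦ ?_, fun x hx ↦ ?_, fun x hx ↦ ?_⟩
    · have : (p * q).1 - (p * q).2 = p.1 * (q.1 - q.2) + (p.1 - p.2) * q.2 := by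
        simp [mul_sub, sub_mul]
      rw [this]
      exact add_mem (h2 _ k1) (k5 _ h1)
    · simpa [mul_assoc] using h2 _ (k2 x hx)
    · simpa [mul_assoc] using k3 _ (h3 x hx)
    · simpa [mul_assoc] using h4 _ (k4 x hx)
    · simpa [mul_assoc] using k5 _ (h5 x hx)
  smul_mem' := by
    rintro c p ⟨h1, h2, h3, h4, h5⟩
    refine ⟨?_, fun x hx ↦ ?_, fun x hx ↦ ?_, fun x hx ↦ ?_, fun x hx ↦ ?_⟩
    · simpa [smul_sub] using SMulMemClass.smul_mem c h1
    · simpa [smul_mul_assoc] using SMulMemClass.smul_mem c (h2 x hx)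
    · simpa [mul_smul_comm] using SMulMemClass.smul_mem c (h3 x hx)
    · simpa [smul_mul_assoc] using SMulMemClass.smul_mem c (h4 x hx)
    · simpa [mul_smul_comm] using SMulMemClass.smul_mem c (h5 x hx)
  star_mem' := by
    rintro p ⟨h1, h2, h3, h4, h5⟩
    refine ⟨?_, fun x hx ↦ ?_, fun x hx ↦ ?_, fun x hx ↦ ?_, fun x hx ↦ ?_⟩
    · simpa using star_mem h1
    · simpa using star_mem (h3 _ (star_mem hx))
    · simpa using star_mem (h2 _ (star_mem hx))
    · simpa using star_mem (h5 _ (star_mem hx))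
    · simpa using star_mem (h4 _ (star_mem hx))

lemma isClosed_congruentPairs {I : NonUnitalStarSubalgebra ℂ 𝔄} (hI : IsClosed (I : Set 𝔄)) :
    IsClosed (congruentPairs I : Set (𝔄 × 𝔄)) := by
  have : (congruentPairs I : Set (𝔄 × 𝔄)) = {p | p.1 - p.2 ∈ (I : Set 𝔄)} ∩
      ((⋂ x ∈ I, {p | p.1 * x ∈ (I : Set 𝔄)}) ∩ ((⋂ x ∈ I, {p | x * p.1 ∈ (I : Set 𝔄)}) ∩
      ((⋂ x ∈ I, {p | p.2 * x ∈ (I : Set 𝔄)}) ∩ ⋂ x ∈ I, {p | x * p.2 ∈ (I : Set 𝔄)}))) := by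
    ext p
    simp only [Set.mem_inter_iff, Set.mem_iInter, Set.mem_ofPred_eq, SetLike.mem_coe]
    rfl
  rw [this]
  refine .inter (hI.preimage (by fun_prop)) (.inter ?_ (.inter ?_ (.inter ?_ ?_))) <;>
  exact isClosed_biInter fun x _ ↦ hI.preimage (by fun_prop)

/-- Functional calculus respects congruence modulo a closed ideal. -/
lemma cfcₙ_sub_cfcₙ_mem {I : NonUnitalStarSubalgebra ℂ 𝔄} (hI : IsClosed (I : Set 𝔄)) {u v : 𝔄}
    (hu : IsSelfAdjoint u) (hv : IsSelfAdjoint v) (huI : ∀ x ∈ I, u * x ∈ I)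
    (hvI : ∀ x ∈ I, v * x ∈ I) (huv : u - v ∈ I) {f : ℝ → ℝ} (hf : Continuous f) :
    cfcₙ f u - cfcₙ f v ∈ I := by
  have hmem : (u, v) ∈ congruentPairs I := by
    refine ⟨huv, huI, fun x hx ↦ ?_, hvI, fun x hx ↦ ?_⟩
    · simpa [hu.star_eq] using star_mem (huI _ (star_mem hx))
    · simpa [hv.star_eq] using star_mem (hvI _ (star_mem hx))
  have hsa : IsSelfAdjoint (u, v) := Prod.ext hu.star_eq hv.star_eq
  have := isClosed_congruentPairs hI
  have h := cfcₙ_mem f hmem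
  rw [cfcₙ_map_prod (S := ℂ) f u v hf.continuousOn hsa hu hv] at h
  exact h.1

lemma norm_le_norm_add_of_isSelfAdjoint {C I : NonUnitalStarSubalgebra ℂ 𝔄}
    (hC : IsClosed (C : Set 𝔄)) (hI : IsClosed (I : Set 𝔄))
    (hCI : ∀ a ∈ C, ∀ x ∈ I, a * x ∈ I) (hdisj : ∀ a ∈ C, a ∈ I → a = 0)
    {a x : 𝔄} (ha : a ∈ C) (hx : x ∈ I) (hsa : IsSelfAdjoint a) (hsx : IsSelfAdjoint x) :
    ‖a‖ ≤ ‖a + x‖ := by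
  have h1 := cfcₙ_sub_cfcₙ_mem hI (hsa.add hsx) hsa
    (fun y hy ↦ by rw [add_mul]; exact add_mem (hCI a ha y hy) (mul_mem hx hy))
    (hCI a ha) (by simpa using hx) (continuous_softThreshold ‖a + x‖)
  rw [cfcₙ_softThreshold_eq_zero (hsa.add hsx) le_rfl, zero_sub, neg_mem_iff] at h1
  have h2 := norm_sub_cfcₙ_softThreshold_le (norm_nonneg (a + x)) hsa
  rwa [hdisj _ (cfcₙ_mem _ ha) h1, sub_zero] at h2

/-- A `C⋆`-algebra acting on an ideal disjoint from it is complemented by the ideal with a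
contractive projection. -/
lemma norm_le_norm_add {C I : NonUnitalStarSubalgebra ℂ 𝔄}
    (hC : IsClosed (C : Set 𝔄)) (hI : IsClosed (I : Set 𝔄))
    (hCI : ∀ a ∈ C, ∀ x ∈ I, a * x ∈ I) (hdisj : ∀ a ∈ C, a ∈ I → a = 0)
    {a x : 𝔄} (ha : a ∈ C) (hx : x ∈ I) : ‖a‖ ≤ ‖a + x‖ := by
  have h1 : star a * x ∈ I := hCI _ (star_mem ha) _ hx
  have h := norm_le_norm_add_of_isSelfAdjoint hC hI hCI hdisj (a := star a * a)
    (x := star a * x + star x * a + star x * x) (mul_mem (star_mem ha) ha)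
    (add_mem (add_mem h1 (by simpa using star_mem h1)) (mul_mem (star_mem hx) hx))
    (.star_mul_self a) (by
      simp only [IsSelfAdjoint, star_add, star_mul, star_star]
      abel)
  have h2 : star a * a + (star a * x + star x * a + star x * x) = star (a + x) * (a + x) := by
    simp only [star_add, add_mul, mul_add]
    abel
  rw [h2, CStarRing.norm_star_mul_self, CStarRing.norm_star_mul_self] at h
  exact abs_le_of_sq_le_sq' (by nlinarith) (norm_nonneg _) |>.2

lemma isClosed_sup_of_ideal {C I : NonUnitalStarSubalgebra ℂ 𝔄}
    (hC : IsClosed (C : Set 𝔄)) (hI : IsClosed (I : Set 𝔄))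
    (hCI : ∀ a ∈ C, ∀ x ∈ I, a * x ∈ I) (hdisj : ∀ a ∈ C, a ∈ I → a = 0) :
    IsClosed ((C.toSubmodule ⊔ I.toSubmodule : Submodule ℂ 𝔄) : Set 𝔄) := by
  have := hC.completeSpace_coe
  have := hI.completeSpace_coe
  let φ : C.toSubmodule × I.toSubmodule →ₗ[ℂ] 𝔄 :=
    C.toSubmodule.subtype.coprod I.toSubmodule.subtype
  have hφ : Continuous φ := by
    change Continuous fun p : C.toSubmodule × I.toSubmodule ↦ (p.1 : 𝔄) + p.2
    fun_prop
  have hanti : AntilipschitzWith 2 φ := by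
    refine AddMonoidHomClass.antilipschitz_of_bound φ fun p ↦ ?_
    have h : ‖(p.1 : 𝔄)‖ ≤ ‖(p.1 : 𝔄) + p.2‖ := norm_le_norm_add hC hI hCI hdisj p.1.2 p.2.2
    have h' : ‖(p.2 : 𝔄)‖ ≤ ‖(p.1 : 𝔄) + p.2‖ + ‖(p.1 : 𝔄)‖ := by
      simpa using norm_sub_le ((p.1 : 𝔄) + p.2) (p.1 : 𝔄)
    change max ‖(p.1 : 𝔄)‖ ‖(p.2 : 𝔄)‖ ≤ 2 * ‖(p.1 : 𝔄) + p.2‖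
    exact max_le (by linarith [norm_nonneg (p.1 : 𝔄)]) (by linarith)
  have hu : UniformContinuous φ :=
    uniformContinuous_addMonoidHom_of_continuous (f := φ.toAddMonoidHom) hφ
  have : CompleteSpace C.toSubmodule := hC.completeSpace_coe
  have : CompleteSpace I.toSubmodule := hI.completeSpace_coe
  have hcl := hanti.isClosed_range hu
  rwa [← LinearMap.coe_range, LinearMap.range_coprod, Submodule.range_subtype,
    Submodule.range_subtype] at hcl

end CStar

lemma Finset.exists_infClosed_superset {𝓛 : Type*} [SemilatticeInf 𝓛] (F : Finset 𝓛) :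
    ∃ G : Finset 𝓛, F ⊆ G ∧ ∀ i ∈ G, ∀ j ∈ G, i ⊓ j ∈ G := by
  classical
  induction F using Finset.induction_on with
  | empty => exact ⟨∅, by simp⟩
  | insert a F _ ih =>
    obtain ⟨G, hFG, hG⟩ := ih
    refine ⟨insert a (G ∪ G.image (a ⊓ ·)), by grind, ?_⟩
    have h (i : 𝓛) : i ∈ insert a (G ∪ G.image (a ⊓ ·)) ↔
        i = a ∨ i ∈ G ∨ ∃ k ∈ G, a ⊓ k = i := by simp
    simp only [h]
    rintro i (rfl | hi | ⟨k, hk, rfl⟩) j (rfl | hj | ⟨l, hl, rfl⟩)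
    · simp
    · exact .inr (.inr ⟨j, hj, rfl⟩)
    · exact .inr (.inr ⟨l, hl, by simp⟩)
    · exact .inr (.inr ⟨i, hi, inf_comm _ _⟩)
    · exact .inr (.inl (hG _ hi _ hj))
    · exact .inr (.inr ⟨i ⊓ l, hG _ hi _ hl, by rw [inf_left_comm]⟩)
    · exact .inr (.inr ⟨k, hk, by rw [inf_right_comm, inf_idem]⟩)
    · exact .inr (.inr ⟨k ⊓ j, hG _ hk _ hj, by rw [inf_assoc]⟩)
    · exact .inr (.inr ⟨k ⊓ l, hG _ hk _ hl, by rw [inf_inf_distrib_left]⟩)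

section FinsetSpan

variable {𝓛 : Type*} {𝔄 : Type*} [NonUnitalCStarAlgebra 𝔄]

/-- The algebraic sum of finitely many components. -/
def finsetSpan (B : 𝓛 → NonUnitalStarSubalgebra ℂ 𝔄) (F : Finset 𝓛) : Submodule ℂ 𝔄 :=
  ⨆ i ∈ F, (B i).toSubmodule

lemma mem_finsetSpan {B : 𝓛 → NonUnitalStarSubalgebra ℂ 𝔄} {F : Finset 𝓛} {z : 𝔄} :
    z ∈ finsetSpan B F ↔ ∃ x : 𝓛 → 𝔄, (∀ i, x i ∈ B i) ∧ ∑ i ∈ F, x i = z := by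
  rw [finsetSpan, Submodule.mem_iSup_finset_iff_exists_sum]
  exact ⟨fun ⟨μ, h⟩ ↦ ⟨fun i ↦ μ i, fun i ↦ (μ i).2, h⟩, fun ⟨x, hx, h⟩ ↦ ⟨fun i ↦ ⟨x i, hx i⟩, h⟩⟩

lemma mem_finsetSpan_of_mem {B : 𝓛 → NonUnitalStarSubalgebra ℂ 𝔄} {F : Finset 𝓛} {i : 𝓛}
    (hi : i ∈ F) {z : 𝔄} (hz : z ∈ B i) : z ∈ finsetSpan B F :=
  Submodule.mem_iSup_of_mem i (Submodule.mem_iSup_of_mem hi hz)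

lemma finsetSpan_mono (B : 𝓛 → NonUnitalStarSubalgebra ℂ 𝔄) {F G : Finset 𝓛} (h : F ⊆ G) :
    finsetSpan B F ≤ finsetSpan B G :=
  iSup_le fun _ ↦ iSup_le fun hi _ hz ↦ mem_finsetSpan_of_mem (h hi) hz

lemma finsetSpan_mono_left {A B : 𝓛 → NonUnitalStarSubalgebra ℂ 𝔄} (h : ∀ i, A i ≤ B i)
    (F : Finset 𝓛) : finsetSpan A F ≤ finsetSpan B F :=
  iSup_le fun i ↦ iSup_le fun hi _ hz ↦ mem_finsetSpan_of_mem hi (h i hz)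

lemma star_mem_finsetSpan {B : 𝓛 → NonUnitalStarSubalgebra ℂ 𝔄} {F : Finset 𝓛} {z : 𝔄}
    (hz : z ∈ finsetSpan B F) : star z ∈ finsetSpan B F := by
  obtain ⟨x, hx, rfl⟩ := mem_finsetSpan.mp hz
  exact mem_finsetSpan.mpr ⟨fun i ↦ star (x i), fun i ↦ star_mem (hx i), by simp⟩

lemma eq_of_sum_eq_sum {B : 𝓛 → NonUnitalStarSubalgebra ℂ 𝔄}
    (hindep : ∀ (s : Finset 𝓛) (x : 𝓛 → 𝔄), (∀ i, x i ∈ B i) →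
        ∑ i ∈ s, x i = 0 → ∀ i ∈ s, x i = 0) {F G : Finset 𝓛} {x y : 𝓛 → 𝔄}
    (hx : ∀ i, x i ∈ B i) (hy : ∀ i, y i ∈ B i) (h : ∑ i ∈ F, x i = ∑ i ∈ G, y i)
    {i : 𝓛} (hi : i ∈ F) : x i = open Classical in if i ∈ G then y i else 0 := by
  classical
  have key := hindep (F ∪ G) (fun j ↦ (if j ∈ F then x j else 0) - if j ∈ G then y j else 0)
    (fun j ↦ sub_mem (by split_ifs <;> simp [hx]) (by split_ifs <;> simp [hy])) (by
      rw [Finset.sum_sub_distrib, Finset.sum_ite_mem, Finset.sum_ite_mem,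
        Finset.inter_eq_right.mpr Finset.subset_union_left,
        Finset.inter_eq_right.mpr Finset.subset_union_right, h, sub_self])
    i (Finset.mem_union_left _ hi)
  simpa [hi, sub_eq_zero] using key

lemma eq_zero_of_mem_finsetSpan {B : 𝓛 → NonUnitalStarSubalgebra ℂ 𝔄}
    (hindep : ∀ (s : Finset 𝓛) (x : 𝓛 → 𝔄), (∀ i, x i ∈ B i) →
        ∑ i ∈ s, x i = 0 → ∀ i ∈ s, x i = 0) {F : Finset 𝓛} {i : 𝓛} (hi : i ∉ F) {a : 𝔄}
    (ha : a ∈ B i) (haF : a ∈ finsetSpan B F) : a = 0 := by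
  classical
  obtain ⟨y, hy, hya⟩ := mem_finsetSpan.mp haF
  have := eq_of_sum_eq_sum hindep (F := {i}) (G := F) (x := Pi.single i a) (y := y) (i := i)
    (fun j ↦ by
      obtain rfl | h := eq_or_ne j i
      · simpa using ha
      · simp [h]) hy (by simp [hya]) (by simp)
  simpa [hi] using this

lemma exists_finsetSpan_of_mem_span {A : 𝓛 → NonUnitalStarSubalgebra ℂ 𝔄} {y : 𝔄}
    (hy : y ∈ Submodule.span ℂ (⋃ i, (A i : Set 𝔄))) : ∃ F, y ∈ finsetSpan A F := by
  have h : Submodule.span ℂ (⋃ i, (A i : Set 𝔄)) ≤ ⨆ i, (A i).toSubmodule :=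
    Submodule.span_le.mpr (Set.iUnion_subset fun i _ hz ↦ Submodule.mem_iSup_of_mem i hz)
  exact Submodule.mem_iSup_iff_exists_finset.mp (h hy)

end FinsetSpan

section Graded

variable {𝓛 : Type*} [SemilatticeInf 𝓛] {𝔄 : Type*} [NonUnitalCStarAlgebra 𝔄]

lemma mul_mem_finsetSpan {B : 𝓛 → NonUnitalStarSubalgebra ℂ 𝔄}
    (hmul : ∀ i j : 𝓛, ∀ x ∈ B i, ∀ y ∈ B j, x * y ∈ B (i ⊓ j)) {F G H : Finset 𝓛}
    (h : ∀ i ∈ F, ∀ j ∈ G, i ⊓ j ∈ H) {y z : 𝔄} (hy : y ∈ finsetSpan B F)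
    (hz : z ∈ finsetSpan B G) : y * z ∈ finsetSpan B H := by
  obtain ⟨u, hu, rfl⟩ := mem_finsetSpan.mp hy
  obtain ⟨v, hv, rfl⟩ := mem_finsetSpan.mp hz
  rw [Finset.sum_mul_sum]
  exact Submodule.sum_mem _ fun i hi ↦ Submodule.sum_mem _ fun j hj ↦
    mem_finsetSpan_of_mem (h i hi j hj) (hmul i j _ (hu i) _ (hv j))

/-- The sum of the components over a finite subsemilattice, as a star subalgebra. -/
def finsetSubalgebra (B : 𝓛 → NonUnitalStarSubalgebra ℂ 𝔄)
    (hmul : ∀ i j : 𝓛, ∀ x ∈ B i, ∀ y ∈ B j, x * y ∈ B (i ⊓ j)) (F : Finset 𝓛)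
    (hF : ∀ i ∈ F, ∀ j ∈ F, i ⊓ j ∈ F) : NonUnitalStarSubalgebra ℂ 𝔄 where
  __ := finsetSpan B F
  mul_mem' hy hz := mul_mem_finsetSpan hmul hF hy hz
  star_mem' hz := star_mem_finsetSpan hz

/-- Finite sums of components over subsemilattices are closed. -/
lemma isClosed_finsetSpan {B : 𝓛 → NonUnitalStarSubalgebra ℂ 𝔄}
    (hclosed : ∀ i, IsClosed (B i : Set 𝔄))
    (hindep : ∀ (s : Finset 𝓛) (x : 𝓛 → 𝔄), (∀ i, x i ∈ B i) →
        ∑ i ∈ s, x i = 0 → ∀ i ∈ s, x i = 0)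
    (hmul : ∀ i j : 𝓛, ∀ x ∈ B i, ∀ y ∈ B j, x * y ∈ B (i ⊓ j)) (F : Finset 𝓛)
    (hF : ∀ i ∈ F, ∀ j ∈ F, i ⊓ j ∈ F) : IsClosed (finsetSpan B F : Set 𝔄) := by
  classical
  induction F using Finset.strongInduction with
  | H F ih =>
  obtain rfl | hne := F.eq_empty_or_nonempty
  · simp [finsetSpan]
  obtain ⟨m, hm⟩ := F.exists_maximal hne
  have hlt : ∀ i ∈ F, ∀ j ∈ F.erase m, i ⊓ j ∈ F.erase m := by
    intro i hi j hj
    obtain ⟨hjm, hj⟩ := Finset.mem_erase.mp hj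
    refine Finset.mem_erase.mpr ⟨fun h ↦ hjm ?_, hF i hi j hj⟩
    have hmj : m ≤ j := h ▸ inf_le_right
    exact le_antisymm (hm.2 hj hmj) hmj
  have hF' : ∀ i ∈ F.erase m, ∀ j ∈ F.erase m, i ⊓ j ∈ F.erase m :=
    fun i hi ↦ hlt i (Finset.mem_of_mem_erase hi)
  have hsup := isClosed_sup_of_ideal (C := B m) (I := finsetSubalgebra B hmul (F.erase m) hF')
    (hclosed m) (ih _ (Finset.erase_ssubset hm.1) hF')
    (fun a ha x hx ↦ mul_mem_finsetSpan hmul hlt (mem_finsetSpan_of_mem hm.1 ha) hx)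
    (fun a ha haI ↦ eq_zero_of_mem_finsetSpan hindep (Finset.notMem_erase m F) ha haI)
  have hEq : finsetSpan B F = (B m).toSubmodule ⊔ finsetSpan B (F.erase m) := by
    conv_lhs => rw [← Finset.insert_erase hm.1]
    simp only [finsetSpan, Finset.iSup_insert]
  rw [hEq]
  exact hsup

/-- A self-adjoint element of a component which is `ε`-close to a self-adjoint finite sum of
elements of the `A j` is `2ε`-close to `A i`. -/
lemma exists_mem_norm_sub_le {A B : 𝓛 → NonUnitalStarSubalgebra ℂ 𝔄}
    (hA_closed : ∀ i, IsClosed (A i : Set 𝔄)) (hB_closed : ∀ i, IsClosed (B i : Set 𝔄))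
    (hB_indep : ∀ (s : Finset 𝓛) (x : 𝓛 → 𝔄), (∀ i, x i ∈ B i) →
        ∑ i ∈ s, x i = 0 → ∀ i ∈ s, x i = 0)
    (hA_mul : ∀ i j : 𝓛, ∀ x ∈ A i, ∀ y ∈ A j, x * y ∈ A (i ⊓ j))
    (hB_mul : ∀ i j : 𝓛, ∀ x ∈ B i, ∀ y ∈ B j, x * y ∈ B (i ⊓ j))
    (hAB : ∀ i, A i ≤ B i) {F : Finset 𝓛} (hF : ∀ i ∈ F, ∀ j ∈ F, i ⊓ j ∈ F) {i : 𝓛}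
    (hi : i ∈ F) {b y : 𝔄} (hb : b ∈ B i) (hbs : IsSelfAdjoint b) (hy : y ∈ finsetSpan A F)
    (hys : IsSelfAdjoint y) : ∃ a ∈ A i, ‖b - a‖ ≤ 2 * ‖b - y‖ := by
  classical
  set N : Finset 𝓛 := F.filter (· ≤ i) with hN
  set M : Finset 𝓛 := F.filter (· < i) with hM
  have hFN : ∀ j ∈ F, ∀ k ∈ N, j ⊓ k ∈ N := by
    intro j hj k hk
    obtain ⟨hk, hki⟩ := Finset.mem_filter.mp hk
    exact Finset.mem_filter.mpr ⟨hF j hj k hk, inf_le_right.trans hki⟩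
  have hNN : ∀ j ∈ N, ∀ k ∈ N, j ⊓ k ∈ N := fun j hj ↦ hFN j (Finset.mem_filter.mp hj).1
  have hFM : ∀ j ∈ F, ∀ k ∈ M, j ⊓ k ∈ M := by
    intro j hj k hk
    obtain ⟨hk, hki⟩ := Finset.mem_filter.mp hk
    exact Finset.mem_filter.mpr ⟨hF j hj k hk, inf_le_right.trans_lt hki⟩
  have hMM : ∀ j ∈ M, ∀ k ∈ M, j ⊓ k ∈ M := fun j hj ↦ hFM j (Finset.mem_filter.mp hj).1
  have hA_indep : ∀ (s : Finset 𝓛) (x : 𝓛 → 𝔄), (∀ i, x i ∈ A i) →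
      ∑ i ∈ s, x i = 0 → ∀ i ∈ s, x i = 0 :=
    fun s x hx ↦ hB_indep s x fun j ↦ hAB j (hx j)
  have hiN : i ∈ N := Finset.mem_filter.mpr ⟨hi, le_rfl⟩
  have hyB : y ∈ finsetSpan B F := finsetSpan_mono_left hAB F hy
  have hbF : b ∈ finsetSpan B F := mem_finsetSpan_of_mem hi hb
  set ε := ‖b - y‖ with hε
  set z := cfcₙ (softThreshold ε) y with hz
  have hzA : z ∈ finsetSpan A F := by
    have : IsClosed (finsetSubalgebra A hA_mul F hF : Set 𝔄) :=
      isClosed_finsetSpan hA_closed hA_indep hA_mul F hF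
    exact cfcₙ_mem (s := finsetSubalgebra A hA_mul F hF) (softThreshold ε) hy
  have hzB : z ∈ finsetSpan B N := by
    have h := cfcₙ_sub_cfcₙ_mem (I := finsetSubalgebra B hB_mul N hNN)
      (isClosed_finsetSpan hB_closed hB_indep hB_mul N hNN) hys (hys.sub hbs)
      (fun x hx ↦ mul_mem_finsetSpan hB_mul hFN hyB hx)
      (fun x hx ↦ mul_mem_finsetSpan hB_mul hFN (sub_mem hyB hbF) hx)
      (by rw [sub_sub_cancel]; exact mem_finsetSpan_of_mem hiN hb) (continuous_softThreshold ε)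
    rw [cfcₙ_softThreshold_eq_zero (hys.sub hbs) (norm_sub_rev y b).le, sub_zero] at h
    exact h
  obtain ⟨α, hα, hαz⟩ := mem_finsetSpan.mp hzA
  obtain ⟨β, hβ, hβz⟩ := mem_finsetSpan.mp hzB
  have hαβ : α i = β i := by
    simpa [hiN] using
      eq_of_sum_eq_sum hB_indep (fun j ↦ hAB j (hα j)) hβ (hαz.trans hβz.symm) hi
  refine ⟨α i, hα i, ?_⟩
  have hNM : N = insert i M := by
    ext j
    simp only [hN, hM, Finset.mem_filter, Finset.mem_insert, le_iff_eq_or_lt]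
    grind
  have hiM : i ∉ M := by simp [hM]
  have hsplit : b - z = (b - α i) + -∑ j ∈ M, β j := by
    rw [← hβz, hNM, Finset.sum_insert hiM, hαβ]
    abel
  have h1 : ‖b - α i‖ ≤ ‖b - z‖ := by
    rw [hsplit]
    exact norm_le_norm_add (C := B i) (I := finsetSubalgebra B hB_mul M hMM) (hB_closed i)
      (isClosed_finsetSpan hB_closed hB_indep hB_mul M hMM)
      (fun a ha x hx ↦ mul_mem_finsetSpan hB_mul hFM (mem_finsetSpan_of_mem hi ha) hx)
      (fun a ha haI ↦ eq_zero_of_mem_finsetSpan hB_indep hiM ha haI)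
      (sub_mem hb (hAB i (hα i))) (neg_mem (mem_finsetSpan.mpr ⟨β, hβ, rfl⟩))
  have h2 : ‖y - z‖ ≤ ε := norm_sub_cfcₙ_softThreshold_le (norm_nonneg _) hys
  have h3 : ‖b - z‖ ≤ ‖b - y‖ + ‖y - z‖ := norm_sub_le_norm_sub_add_norm_sub b y z
  linarith

lemma mem_of_isSelfAdjoint_of_mem {A B : 𝓛 → NonUnitalStarSubalgebra ℂ 𝔄}
    (hA_closed : ∀ i, IsClosed (A i : Set 𝔄)) (hB_closed : ∀ i, IsClosed (B i : Set 𝔄))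
    (hA_total : closure (Submodule.span ℂ (⋃ i, (A i : Set 𝔄)) : Set 𝔄) = Set.univ)
    (hB_indep : ∀ (s : Finset 𝓛) (x : 𝓛 → 𝔄), (∀ i, x i ∈ B i) →
        ∑ i ∈ s, x i = 0 → ∀ i ∈ s, x i = 0)
    (hA_mul : ∀ i j : 𝓛, ∀ x ∈ A i, ∀ y ∈ A j, x * y ∈ A (i ⊓ j))
    (hB_mul : ∀ i j : 𝓛, ∀ x ∈ B i, ∀ y ∈ B j, x * y ∈ B (i ⊓ j))
    (hAB : ∀ i, A i ≤ B i) {i : 𝓛} {b : 𝔄} (hb : b ∈ B i) (hbs : IsSelfAdjoint b) : b ∈ A i := by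
  classical
  refine (hA_closed i).closure_subset (Metric.mem_closure_iff.mpr fun ε hε ↦ ?_)
  have hbc : b ∈ closure (Submodule.span ℂ (⋃ i, (A i : Set 𝔄)) : Set 𝔄) := hA_total ▸ trivial
  obtain ⟨w, hw, hbw⟩ := Metric.mem_closure_iff.mp hbc (ε / 2) (by positivity)
  obtain ⟨F₀, hwF⟩ := exists_finsetSpan_of_mem_span hw
  obtain ⟨F, hF₀F, hF⟩ := (insert i F₀).exists_infClosed_superset
  have hwF : w ∈ finsetSpan A F :=
    finsetSpan_mono A ((Finset.subset_insert i F₀).trans hF₀F) hwF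
  have hyF : (realPart w : 𝔄) ∈ finsetSpan A F := by
    rw [realPart_apply_coe, ← Complex.coe_smul]
    exact Submodule.smul_mem _ _ (add_mem hwF (star_mem_finsetSpan hwF))
  obtain ⟨a, ha, hba⟩ := exists_mem_norm_sub_le hA_closed hB_closed hB_indep hA_mul hB_mul hAB hF
    (hF₀F (Finset.mem_insert_self i F₀)) hb hbs hyF (realPart w).2
  have hle : ‖b - realPart w‖ ≤ ‖b - w‖ := by
    have : b - realPart w = realPart (b - w) := by
      rw [map_sub, AddSubgroupClass.coe_sub, hbs.coe_realPart]
    rw [this]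
    exact realPart.norm_le (b - w)
  refine ⟨a, ha, ?_⟩
  rw [dist_eq_norm] at hbw ⊢
  linarith

lemma component_le {A B : 𝓛 → NonUnitalStarSubalgebra ℂ 𝔄}
    (hA_closed : ∀ i, IsClosed (A i : Set 𝔄)) (hB_closed : ∀ i, IsClosed (B i : Set 𝔄))
    (hA_total : closure (Submodule.span ℂ (⋃ i, (A i : Set 𝔄)) : Set 𝔄) = Set.univ)
    (hB_indep : ∀ (s : Finset 𝓛) (x : 𝓛 → 𝔄), (∀ i, x i ∈ B i) →
        ∑ i ∈ s, x i = 0 → ∀ i ∈ s, x i = 0)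
    (hA_mul : ∀ i j : 𝓛, ∀ x ∈ A i, ∀ y ∈ A j, x * y ∈ A (i ⊓ j))
    (hB_mul : ∀ i j : 𝓛, ∀ x ∈ B i, ∀ y ∈ B j, x * y ∈ B (i ⊓ j))
    (hAB : ∀ i, A i ≤ B i) (i : 𝓛) : B i ≤ A i := by
  have key {b : 𝔄} (hb : b ∈ B i) : (realPart b : 𝔄) ∈ A i := by
    refine mem_of_isSelfAdjoint_of_mem hA_closed hB_closed hA_total hB_indep hA_mul hB_mul hAB
      ?_ (realPart b).2
    rw [realPart_apply_coe, ← Complex.coe_smul]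
    exact SMulMemClass.smul_mem _ (add_mem hb (star_mem hb))
  intro b hb
  have h2 : (imaginaryPart b : 𝔄) ∈ A i := by
    have := key (SMulMemClass.smul_mem (-Complex.I) hb)
    simpa [realPart_I_smul] using this
  rw [← realPart_add_I_smul_imaginaryPart b]
  exact add_mem (key hb) (SMulMemClass.smul_mem _ h2)

end Graded


theorem stmt_9
    {𝓛 : Type*} [SemilatticeInf 𝓛]
    {𝔄 : Type*} [NonUnitalNormedRing 𝔄] [StarRing 𝔄] [CStarRing 𝔄]
    [NormedSpace ℂ 𝔄] [IsScalarTower ℂ 𝔄 𝔄] [SMulCommClass ℂ 𝔄 𝔄]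
    [StarModule ℂ 𝔄] [CompleteSpace 𝔄]
    (A B : 𝓛 → NonUnitalStarSubalgebra ℂ 𝔄)
    (hA_closed : ∀ i : 𝓛, IsClosed ((A i : Set 𝔄)))
    (hB_closed : ∀ i : 𝓛, IsClosed ((B i : Set 𝔄)))
    (hA_total : closure ((Submodule.span ℂ (⋃ i : 𝓛, (A i : Set 𝔄)) : Submodule ℂ 𝔄) : Set 𝔄) = Set.univ)
    (hB_indep : ∀ (s : Finset 𝓛) (x : 𝓛 → 𝔄), (∀ i, x i ∈ B i) →
        ∑ i ∈ s, x i = 0 → ∀ i ∈ s, x i = 0)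
    (hA_mul : ∀ i j : 𝓛, ∀ x ∈ A i, ∀ y ∈ A j, x * y ∈ A (i ⊓ j))
    (hB_mul : ∀ i j : 𝓛, ∀ x ∈ B i, ∀ y ∈ B j, x * y ∈ B (i ⊓ j))
    (hAB : ∀ i : 𝓛, (A i : Set 𝔄) ⊆ (B i : Set 𝔄)) :
    (∀ (s : Finset 𝓛) (x : 𝓛 → 𝔄), (∀ i, x i ∈ A i) →
        ∑ i ∈ s, x i = 0 → ∀ i ∈ s, x i = 0) ∧
    (closure ((Submodule.span ℂ (⋃ i : 𝓛, (B i : Set 𝔄)) : Submodule ℂ 𝔄) : Set 𝔄) = Set.univ) ∧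
    (∀ i : 𝓛, A i = B i) := by
  let _ : NonUnitalCStarAlgebra 𝔄 := { }
  refine ⟨fun s x hx ↦ hB_indep s x fun i ↦ hAB i (hx i), ?_, fun i ↦ le_antisymm (hAB i) ?_⟩
  · rw [← Set.univ_subset_iff, ← hA_total]
    exact closure_mono (Submodule.span_mono (Set.iUnion_mono hAB))
  · exact component_le hA_closed hB_closed hA_total hB_indep hA_mul hB_mul hAB i
end
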